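/- arXiv:1306.1983 — 8 statements merged into one kernel-verified Lean document; each statement's English description precedes it below -/
import Mathlib

section
/- If the W-fan Σ is relatively full-dimensional, i.e., Σ contains a polycone of dimension dim(Σ) := dim_ℝ span_ℝ(⋃Σ), then the Picard module Pic_W(Σ) is a free R-module. -/
open Module

noncomputable section
open scoped Classical

namespace ToricStmt

variable {V : Type*} [AddCommGroup V] [Module ℝ V]

/-- The conic hull of a set: all finite linear combinations with nonnegative real
coefficients. -/
def coneHull (A : Set V) : Set V :=
  {x | ∃ (s : Finset V) (c : V → ℝ), (s : Set V) ⊆ A ∧ (∀ v ∈ s, 0 ≤ c v) ∧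
    x = ∑ v ∈ s, c v • v}

/-- `τ` is a face of `σ`. -/
def IsFaceOf (τ σ : Set V) : Prop :=
  ∃ u : Module.Dual ℝ V, (∀ x ∈ σ, 0 ≤ u x) ∧ τ = σ ∩ {x | u x = 0}

/-- A set is sharp if it contains no line. -/
def IsSharp (σ : Set V) : Prop :=
  ¬ ∃ p v : V, v ≠ 0 ∧ ∀ t : ℝ, p + t • v ∈ σ

section Polycones

variable {R : Type*} [CommSemiring R] [Module R V]

/-- A `W`-polycone: the conic hull of a finite subset of `W`. -/
def IsPolycone (W : Submodule R V) (σ : Set V) : Prop :=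
  ∃ A : Finset V, (A : Set V) ⊆ (W : Set V) ∧ σ = coneHull (A : Set V)

/-- A `W`-fan: a finite set of sharp `W`-polycones such that the intersection of any two
members is a face of each of them, and all faces of members are members. -/
def IsFan (W : Submodule R V) (F : Set (Set V)) : Prop :=
  F.Finite ∧ (∀ σ ∈ F, IsPolycone W σ ∧ IsSharp σ) ∧
    (∀ σ ∈ F, ∀ τ ∈ F, IsFaceOf (σ ∩ τ) σ) ∧
    ∀ σ ∈ F, ∀ τ : Set V, IsFaceOf τ σ → τ ∈ F

end Polycones

section RStructure

variable (R : Type*) [CommSemiring R] [Algebra R ℝ] [Module R V] [IsScalarTower R ℝ V]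

/-- `W` is an `R`-structure on `V` if the canonical map `ℝ ⊗_R W → V` is bijective. -/
def IsRStructure (W : Submodule R V) : Prop :=
  Function.Bijective (W.subtype.liftBaseChange ℝ)

end RStructure

section Picard

variable {R : Type*} [CommRing R] [Module R V]

/-- The submodule of the dual of `W` consisting of forms vanishing on `W ∩ σ`;
this encodes `σ^⊥ ∩ W*`. -/
def perpDual (W : Submodule R V) (σ : Set V) : Submodule R (Module.Dual R W) where
  carrier := {m | ∀ w : W, (w : V) ∈ σ → m w = 0}
  add_mem' := by
    intro a b ha hb w hw
    simp [ha w hw, hb w hw]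
  zero_mem' := by
    intro w hw
    simp
  smul_mem' := by
    intro c m hm w hw
    simp [hm w hw]

variable (W : Submodule R V) (F : Set (Set V))

/-- The submodule of families `(m_σ)_{σ∈Σ}` with every component in `σ^⊥ ∩ W*`. -/
def zeroSub : Submodule R (↥F → Module.Dual R W) :=
  Submodule.pi Set.univ fun σ : ↥F => perpDual W σ.1

/-- The module `P_{W,Σ}` of families `(m_σ + σ^∨)_{σ∈Σ}`. -/
abbrev PMod := (↥F → Module.Dual R W) ⧸ zeroSub W F

/-- Families `(m_σ)` with `m_σ - m_τ ∈ τ^⊥` whenever `τ` is a face of `σ`. -/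
def goodFam : Submodule R (↥F → Module.Dual R W) where
  carrier := {m | ∀ σ τ : ↥F, IsFaceOf (τ : Set V) (σ : Set V) →
    m σ - m τ ∈ perpDual W (τ : Set V)}
  add_mem' := by
    intro a b ha hb σ τ h
    have heq : (a + b) σ - (a + b) τ = (a σ - a τ) + (b σ - b τ) := by
      simp only [Pi.add_apply]; abel
    rw [heq]
    exact add_mem (ha σ τ h) (hb σ τ h)
  zero_mem' := by
    intro σ τ h
    simp only [Pi.zero_apply, sub_zero]; exact (perpDual W (τ : Set V)).zero_mem
  smul_mem' := by
    intro c m hm σ τ h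
    have heq : (c • m) σ - (c • m) τ = c • (m σ - m τ) := by
      simp only [Pi.smul_apply]; rw [smul_sub]
    rw [heq]
    exact Submodule.smul_mem _ c (hm σ τ h)

/-- The module of virtual polytopes `\overline{P}_{W,Σ}`, as a submodule of `P_{W,Σ}`. -/
def vpSub : Submodule R (PMod W F) := (goodFam W F).map (zeroSub W F).mkQ

/-- The diagonal map `W* → (W*)^Σ`. -/
def diagMap : Module.Dual R W →ₗ[R] (↥F → Module.Dual R W) :=
  LinearMap.pi fun _ => LinearMap.id

/-- The submodule `K_{W,Σ}` of `P_{W,Σ}`: the image of the diagonal. -/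
def kSub : Submodule R (PMod W F) :=
  LinearMap.range ((zeroSub W F).mkQ ∘ₗ diagMap W F)

/-- The Picard module `Pic_W(Σ) = \overline{P}_{W,Σ} / K_{W,Σ}`. -/
abbrev PicMod := ↥(vpSub W F) ⧸ ((kSub W F).comap (vpSub W F).subtype)

/-- The canonical surjection `e_{W,Σ}` from the virtual polytopes onto the Picard module. -/
def picQ : ↥(vpSub W F) →ₗ[R] PicMod W F :=
  Submodule.mkQ _

end Picard

section RStructureLemmas

variable {V : Type*} [AddCommGroup V] [Module ℝ V] {R : Type*} [CommRing R] [Algebra R ℝ]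
  [Module R V] [IsScalarTower R ℝ V] {W : Submodule R V}

theorem subset_coneHull (A : Set V) : A ⊆ coneHull A := fun x hx =>
  ⟨{x}, 1, by simpa using hx, by simp, by simp⟩

theorem coneHull_subset_span (A : Set V) : coneHull A ⊆ Submodule.span ℝ A := by
  rintro x ⟨s, c, hs, -, rfl⟩
  exact Submodule.sum_mem _ fun v hv =>
    Submodule.smul_mem _ _ (Submodule.subset_span (hs hv))

/-- An `R`-linear form on an `R`-structure extends to a real linear form on the ambient space. -/
theorem IsRStructure.exists_extension (hW : IsRStructure R W) (m : Module.Dual R W) :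
    ∃ f : Module.Dual ℝ V, ∀ w : W, f w = algebraMap R ℝ (m w) := by
  let e := LinearEquiv.ofBijective (W.subtype.liftBaseChange ℝ) hW
  refine ⟨((Algebra.linearMap R ℝ ∘ₗ m).liftBaseChange ℝ) ∘ₗ e.symm.toLinearMap, fun w => ?_⟩
  have he : e.symm (w : V) = (1 : ℝ) ⊗ₜ[R] w := by
    rw [LinearEquiv.symm_apply_eq]
    change (w : V) = W.subtype.liftBaseChange ℝ (1 ⊗ₜ[R] w)
    simp
  simp [he]

theorem IsRStructure.span_eq_top (hW : IsRStructure R W) :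
    Submodule.span ℝ (W : Set V) = ⊤ := by
  rw [eq_top_iff]
  rintro v -
  obtain ⟨t, rfl⟩ := hW.2 v
  induction t using TensorProduct.induction_on with
  | zero => simp
  | tmul a w => simpa using Submodule.smul_mem _ a (Submodule.subset_span w.2)
  | add x y hx hy => simpa using add_mem hx hy

/-- A form on an `R`-structure vanishing on `A` vanishes on the real span of `A`. -/
theorem IsRStructure.eq_zero_of_mem_span (hinj : Function.Injective (algebraMap R ℝ))
    (hW : IsRStructure R W) (m : Module.Dual R W) {A : Set V} (hA : A ⊆ W)
    (h : ∀ w : W, (w : V) ∈ A → m w = 0) (w : W) (hw : (w : V) ∈ Submodule.span ℝ A) :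
    m w = 0 := by
  obtain ⟨f, hf⟩ := hW.exists_extension m
  have hker : Submodule.span ℝ A ≤ LinearMap.ker f := by
    refine Submodule.span_le.2 fun a ha => ?_
    simpa [h ⟨a, hA ha⟩ ha] using hf ⟨a, hA ha⟩
  apply hinj
  rw [← hf, map_zero]
  exact hker hw

theorem IsRStructure.isNoetherian_dual [FiniteDimensional ℝ V] [IsNoetherianRing R]
    (hinj : Function.Injective (algebraMap R ℝ)) (hW : IsRStructure R W) :
    IsNoetherian R (Module.Dual R W) := by
  obtain ⟨b, hbW, hspan, hli⟩ := exists_linearIndependent ℝ (W : Set V)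
  have : Finite b := hli.setFinite
  let ev : Module.Dual R W →ₗ[R] b → R :=
    LinearMap.pi fun x => LinearMap.applyₗ (⟨x, hbW x.2⟩ : W)
  refine isNoetherian_of_injective ev ((injective_iff_map_eq_zero ev).2 fun m hm => ?_)
  ext w
  refine hW.eq_zero_of_mem_span hinj m hbW (fun x hx => congrFun hm ⟨x, hx⟩) w ?_
  simp [hspan, hW.span_eq_top]

theorem IsRStructure.perpDual_le_of_subset_span (hinj : Function.Injective (algebraMap R ℝ))
    (hW : IsRStructure R W) {σ τ : Set V} (hσ : IsPolycone W σ)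
    (hτ : τ ⊆ Submodule.span ℝ σ) : perpDual W σ ≤ perpDual W τ := by
  obtain ⟨A, hA, rfl⟩ := hσ
  intro m hm w hw
  exact hW.eq_zero_of_mem_span hinj m hA (fun x hx => hm x (subset_coneHull _ hx)) w
    (Submodule.span_le.2 (coneHull_subset_span _) (hτ hw))

/-- If the real span of a cone of `F` contains all cones of `F`, then membership in the
diagonal submodule can be tested after multiplication by a nonzero scalar. -/
theorem mem_kSub_of_smul_mem [IsDomain R] (hinj : Function.Injective (algebraMap R ℝ))
    (hW : IsRStructure R W) {F : Set (Set V)} {σ : Set V} (hσF : σ ∈ F) (hσ : IsPolycone W σ)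
    (hspan : ∀ τ ∈ F, τ ⊆ Submodule.span ℝ σ) {r : R} (hr : r ≠ 0) {x : PMod W F}
    (hx : r • x ∈ kSub W F) : x ∈ kSub W F := by
  obtain ⟨m, rfl⟩ := (zeroSub W F).mkQ_surjective x
  obtain ⟨u, hu⟩ := hx
  have hmem : ∀ τ : F, u - r • m τ ∈ perpDual W τ.1 := by
    rw [← map_smul, LinearMap.comp_apply, ← sub_eq_zero, ← map_sub, Submodule.mkQ_apply,
      Submodule.Quotient.mk_eq_zero] at hu
    exact fun τ => hu τ trivial
  refine ⟨m ⟨σ, hσF⟩, ?_⟩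
  rw [LinearMap.comp_apply, ← sub_eq_zero, ← map_sub, Submodule.mkQ_apply,
    Submodule.Quotient.mk_eq_zero]
  rintro τ -
  have h := hW.perpDual_le_of_subset_span hinj hσ (hspan τ τ.2) (hmem ⟨σ, hσF⟩)
  have heq : r • (diagMap W F (m ⟨σ, hσF⟩) - m) τ =
      (u - r • m τ) - (u - r • m ⟨σ, hσF⟩) := by
    simp [diagMap, smul_sub]
  have hsmul : r • (diagMap W F (m ⟨σ, hσF⟩) - m) τ ∈ perpDual W τ.1 :=
    heq ▸ sub_mem (hmem τ) h
  exact fun w hw => (mul_eq_zero.1 (hsmul w hw)).resolve_left hr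

end RStructureLemmas

/-- If the `W`-fan `Σ` is relatively full-dimensional, then the Picard
module `Pic_W(Σ)` is a free `R`-module. -/
theorem picMod_free_of_relatively_full_dimensional
    {V : Type*} [AddCommGroup V] [Module ℝ V] [FiniteDimensional ℝ V]
    {R : Type*} [CommRing R] [IsDomain R] [IsPrincipalIdealRing R]
    [Algebra R ℝ] (hinj : Function.Injective (algebraMap R ℝ))
    [Module R V] [IsScalarTower R ℝ V]
    (W : Submodule R V) (hW : IsRStructure R W)
    (F : Set (Set V)) (hF : IsFan W F)
    (hfull : ∃ σ ∈ F, Module.finrank ℝ (Submodule.span ℝ σ) =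
      Module.finrank ℝ (Submodule.span ℝ (⋃₀ F))) :
    Module.Free R (PicMod W F) := by
  obtain ⟨σ, hσF, hdim⟩ := hfull
  have hspan : Submodule.span ℝ σ = Submodule.span ℝ (⋃₀ F) :=
    Submodule.eq_of_le_of_finrank_eq
      (Submodule.span_mono (Set.subset_sUnion_of_mem hσF)) hdim
  have hsub : ∀ τ ∈ F, τ ⊆ Submodule.span ℝ σ := fun τ hτ =>
    hspan ▸ (Set.subset_sUnion_of_mem hτ).trans Submodule.subset_span
  have : Finite F := hF.1
  have : IsNoetherian R (Module.Dual R W) := hW.isNoetherian_dual hinj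
  have : Module.IsTorsionFree R (PicMod W F) := by
    refine .of_smul_eq_zero fun r x hx => or_iff_not_imp_left.2 fun hr => ?_
    obtain ⟨y, rfl⟩ := Submodule.mkQ_surjective _ x
    rw [← map_smul, Submodule.mkQ_apply, Submodule.Quotient.mk_eq_zero] at hx
    rw [Submodule.mkQ_apply, Submodule.Quotient.mk_eq_zero]
    exact mem_kSub_of_smul_mem hinj hW hσF (hF.2.1 σ hσF).1 hsub hr hx
  infer_instance

end ToricStmt
end
end

section
/- Under the canonical embedding b_{W,Σ}, the Picard module satisfies Pic_W(Σ) = ⋂_{σ∈Σ} A^σ_{W,Σ} as sub-R-modules of A_{W,Σ₁}. -/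
open Module

noncomputable section
open scoped Classical

namespace ToricStmt

variable {V : Type*} [AddCommGroup V] [Module ℝ V]

section NSide

variable {V : Type*} [AddCommGroup V] [Module ℝ V]

/-- The set of 1-dimensional members of `Σ`. -/
def raysOf (F : Set (Set V)) : Set (Set V) :=
  {ρ | ρ ∈ F ∧ Module.finrank ℝ (Submodule.span ℝ ρ) = 1}

/-- A `ℤ`-structure on `V`: the canonical map `ℝ ⊗_ℤ N → V` is bijective. -/
def IsZStructure (N : Submodule ℤ V) : Prop :=
  Function.Bijective (N.subtype.liftBaseChange ℝ)

/-- `x` is the `N`-minimal `N`-generator of the one-dimensional polycone `ρ`: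
the minimal element of `(N ∩ ρ) \ {0}` for the ordering `x ≤ y ↔ x ∈ conv{0,y}`. -/
def IsMinGen (N : Submodule ℤ V) (ρ : Set V) (x : V) : Prop :=
  x ∈ N ∧ x ∈ ρ ∧ x ≠ 0 ∧ ∀ y : V, y ∈ N → y ∈ ρ → y ≠ 0 → x ∈ segment ℝ 0 y

/-- The linear map `W* → S^ι`, `m ↦ (m (g i))_{i}`. -/
def evalFam {S : Type*} [CommSemiring S] {M : Type*} [AddCommMonoid M] [Module S M]
    {ι : Type*} (g : ι → M) : Module.Dual S M →ₗ[S] (ι → S) :=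
  LinearMap.pi fun i => LinearMap.applyₗ (g i)

variable {R : Type*} [CommRing R] [Module R V]

/-- The module `A_{W,Σ₁}`: the cokernel of `c_{W,Σ₁} : W* → R^{Σ₁}`. -/
abbrev AMod (W : Submodule R V) {ι : Type*} (g : ι → W) : Type _ :=
  (ι → R) ⧸ LinearMap.range (evalFam (S := R) g)

/-- The canonical projection `a_{W,Σ₁} : R^{Σ₁} → A_{W,Σ₁}`. -/
def aQ (W : Submodule R V) {ι : Type*} (g : ι → W) : (ι → R) →ₗ[R] AMod W g :=
  Submodule.mkQ _

/-- The class `α_ρ ∈ A_{W,Σ₁}` of the standard basis vector `δ_ρ`. -/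
def alphaA (W : Submodule R V) {ι : Type*} (g : ι → W) (i : ι) : AMod W g :=
  aQ W g (Pi.single i 1)

/-- The submodule `A^σ_{W,Σ}` of `A_{W,Σ₁}` generated by the `α_ρ` with
`ρ ∈ Σ₁ \ σ₁`. -/
def ASubmod (W : Submodule R V) (F : Set (Set V)) (g : ↥(raysOf F) → W) (σ : Set V) :
    Submodule R (AMod W g) :=
  Submodule.span R {x | ∃ ρ : ↥(raysOf F), ¬ IsFaceOf (ρ : Set V) σ ∧ x = alphaA W g ρ}

/-- The map `(W*)^Σ → R^{Σ₁}`, `(m_σ)_σ ↦ (m_ρ (ρ_N))_ρ`. -/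
def dFam (W : Submodule R V) (F : Set (Set V)) (g : ↥(raysOf F) → W) :
    (↥F → Module.Dual R W) →ₗ[R] (↥(raysOf F) → R) :=
  LinearMap.pi fun ρ : ↥(raysOf F) =>
    (LinearMap.applyₗ (g ρ)) ∘ₗ (LinearMap.proj (⟨ρ.1, ρ.2.1⟩ : ↥F))

/-- The image of the Picard module `Pic_W(Σ)` in `A_{W,Σ₁}` under the canonical
embedding `b_{W,Σ}`: the set of all `a((m_ρ(ρ_N))_ρ)` for face-compatible families
`(m_σ)_{σ∈Σ}` in `W*`. -/
def picInA (W : Submodule R V) (F : Set (Set V)) (g : ↥(raysOf F) → W) :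
    Submodule R (AMod W g) :=
  (goodFam W F).map ((aQ W g) ∘ₗ (dFam W F g))

/-- `F` is an `R`-basis of `W`. -/
def IsBasisSet (W : Submodule R V) (Fs : Set V) : Prop :=
  Fs ⊆ (W : Set V) ∧ LinearIndependent R ((↑) : Fs → V) ∧ Submodule.span R Fs = W

/-- A `W`-regular polycone: the conic hull of a subset of an `R`-basis of `W`. -/
def IsRegularPolycone (W : Submodule R V) (σ : Set V) : Prop :=
  ∃ E Fs : Set V, E ⊆ Fs ∧ IsBasisSet W Fs ∧ σ = coneHull E

/-- A simplicial polycone: the conic hull of a finite `ℝ`-linearly independent set. -/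
def IsSimplicialPolycone (σ : Set V) : Prop :=
  ∃ E : Set V, E.Finite ∧ LinearIndependent ℝ ((↑) : E → V) ∧ σ = coneHull E

end NSide
/-- A finite set whose convex hull avoids the origin is strictly positive under some linear
form. -/
lemma exists_dual_pos {E : Type*} [AddCommGroup E] [Module ℝ E] [FiniteDimensional ℝ E]
    {S : Set E} (hS : S.Finite) (h : (0 : E) ∉ convexHull ℝ S) :
    ∃ u : Module.Dual ℝ E, ∀ b ∈ S, 0 < u b := by
  let e := (Module.finBasis ℝ E).equivFun
  have h0 : (0 : Fin (finrank ℝ E) → ℝ) ∉ convexHull ℝ ((e : E →ₗ[ℝ] _) '' S) := by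
    rw [← LinearMap.image_convexHull]
    rintro ⟨x, hx, hx0⟩
    have : x = 0 := by simpa using hx0
    exact h (this ▸ hx)
  obtain ⟨f, s, hs, hf⟩ := geometric_hahn_banach_point_closed (convex_convexHull ℝ _)
    ((hS.image _).isCompact_convexHull (𝕜 := ℝ)).isClosed h0
  refine ⟨(f : (Fin (finrank ℝ E) → ℝ) →ₗ[ℝ] ℝ) ∘ₗ (e : E →ₗ[ℝ] _), fun b hb => ?_⟩
  have h1 := hf (e b) (subset_convexHull ℝ _ ⟨b, hb, rfl⟩)
  have h2 : (0 : ℝ) < s := by simpa using hs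
  exact h2.trans h1

lemma coneHull_eq_span {V : Type*} [AddCommGroup V] [Module ℝ V] (A : Finset V) :
    coneHull (A : Set V) = (Submodule.span NNReal (A : Set V) : Set V) := by
  ext x
  constructor
  · rintro ⟨s, c, hs, hc, rfl⟩
    refine Submodule.sum_mem _ fun v hv => ?_
    exact Submodule.smul_mem _ (⟨c v, hc v hv⟩ : NNReal) (Submodule.subset_span (hs hv))
  · intro hx
    obtain ⟨c, -, rfl⟩ := Submodule.mem_span_finset.1 hx
    exact ⟨A, fun v => c v, subset_rfl, fun v _ => (c v).2, rfl⟩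

lemma eq_zero_of_neg_mem_of_sharp {V : Type*} [AddCommGroup V] [Module ℝ V]
    (C : Submodule NNReal V) (hC : IsSharp (C : Set V)) {x : V} (hx : x ∈ C) (hnx : -x ∈ C) :
    x = 0 := by
  by_contra hx0
  refine hC ⟨0, x, hx0, fun t => ?_⟩
  rw [zero_add]
  rcases le_total 0 t with ht | ht
  · exact C.smul_mem (⟨t, ht⟩ : NNReal) hx
  · have h1 : (-t) • (-x) ∈ C := C.smul_mem (⟨-t, neg_nonneg.2 ht⟩ : NNReal) hnx
    rwa [neg_smul_neg] at h1

lemma convexHull_subset_of_sharp {V : Type*} [AddCommGroup V] [Module ℝ V]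
    (C : Submodule NNReal V) (hC : ∀ x ∈ C, -x ∈ C → x = 0) {S : Set V} (hS : S ⊆ C)
    (h0 : (0 : V) ∉ S) : convexHull ℝ S ⊆ {x | x ∈ C ∧ x ≠ 0} := by
  refine convexHull_min (fun x hx => ⟨hS hx, fun h => h0 (h ▸ hx)⟩) ?_
  rintro x ⟨hx, hx0⟩ y ⟨hy, hy0⟩ a b ha hb hab
  have hax : a • x ∈ C := C.smul_mem (⟨a, ha⟩ : NNReal) hx
  have hby : b • y ∈ C := C.smul_mem (⟨b, hb⟩ : NNReal) hy
  refine ⟨C.add_mem hax hby, fun h => ?_⟩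
  have h1 : a • x = 0 := hC _ hax (by rwa [neg_eq_of_add_eq_zero_right h])
  have h2 : b • y = 0 := by rwa [h1, zero_add] at h
  have h3 := (smul_eq_zero.1 h1).resolve_right hx0
  have h4 := (smul_eq_zero.1 h2).resolve_right hy0
  linarith

/-- A sharp polycone is generated by finitely many vectors, each of which spans a
one-dimensional face. -/
lemma exists_generators_of_sharp {V : Type*} [AddCommGroup V] [Module ℝ V]
    [FiniteDimensional ℝ V] (A : Finset V) (hs : IsSharp (coneHull (A : Set V))) :
    ∃ B : Finset V, coneHull (A : Set V) = coneHull (B : Set V) ∧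
      ∀ a ∈ B, a ≠ 0 ∧ ∃ ρ : Set V, IsFaceOf ρ (coneHull (A : Set V)) ∧ a ∈ ρ ∧
        ρ ⊆ Submodule.span ℝ {a} := by
  obtain ⟨B, hB, hmin⟩ := exists_minimal_of_wellFoundedLT
    (fun B : Finset V => Submodule.span NNReal (B : Set V) = Submodule.span NNReal (A : Set V))
    ⟨A, rfl⟩
  have hτ : coneHull (A : Set V) = (Submodule.span NNReal (B : Set V) : Set V) := by
    rw [coneHull_eq_span, hB]
  have hnot : ∀ a ∈ B, a ∉ Submodule.span NNReal ((B.erase a : Finset V) : Set V) := by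
    intro a ha hmem
    have h1 : Submodule.span NNReal ((B.erase a : Finset V) : Set V) =
        Submodule.span NNReal (A : Set V) := by
      rw [← hB, ← Submodule.span_insert_eq_span hmem, ← Finset.coe_insert,
        Finset.insert_erase ha]
    exact Finset.notMem_erase a B (hmin h1 (Finset.erase_subset a B) ha)
  have hne : ∀ a ∈ B, a ≠ 0 := fun a ha h => hnot a ha (h ▸ Submodule.zero_mem _)
  refine ⟨B, by rw [hτ, coneHull_eq_span], fun a ha => ⟨hne a ha, ?_⟩⟩
  rw [hτ] at hs ⊢
  set C := Submodule.span NNReal (B : Set V) with hC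
  set D := Submodule.span NNReal ((B.erase a : Finset V) : Set V) with hD
  have hDC : D ≤ C := Submodule.span_mono (by simp)
  have haC : a ∈ C := Submodule.subset_span ha
  have hsharp : ∀ x ∈ C, -x ∈ C → x = 0 := fun x => eq_zero_of_neg_mem_of_sharp C hs
  have h0 : (0 : V ⧸ Submodule.span ℝ {a}) ∉
      convexHull ℝ ((Submodule.span ℝ {a}).mkQ '' ((B.erase a : Finset V) : Set V)) := by
    rw [← LinearMap.image_convexHull]
    rintro ⟨x, hx, hx0⟩
    obtain ⟨hxD, hxne⟩ := convexHull_subset_of_sharp D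
      (fun y hy hny => hsharp y (hDC hy) (hDC hny)) Submodule.subset_span
      (fun h => hne 0 (Finset.mem_of_mem_erase h) rfl) hx
    rw [Submodule.mkQ_apply, Submodule.Quotient.mk_eq_zero] at hx0
    obtain ⟨t, rfl⟩ := Submodule.mem_span_singleton.1 hx0
    rcases lt_trichotomy t 0 with ht | rfl | ht
    · refine hxne (hsharp _ (hDC hxD) ?_)
      rw [← neg_smul]
      exact C.smul_mem (⟨-t, neg_nonneg.2 ht.le⟩ : NNReal) haC
    · exact hxne (zero_smul ℝ a)
    · have h1 : t⁻¹ • t • a ∈ D := D.smul_mem (⟨t⁻¹, inv_nonneg.2 ht.le⟩ : NNReal) hxD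
      rw [inv_smul_smul₀ ht.ne'] at h1
      exact hnot a ha h1
  obtain ⟨u, hu⟩ := exists_dual_pos ((B.erase a).finite_toSet.image _) h0
  let v : Module.Dual ℝ V := u ∘ₗ (Submodule.span ℝ {a}).mkQ
  have hva : v a = 0 := by
    have : (Submodule.span ℝ {a}).mkQ a = 0 := by
      rw [Submodule.mkQ_apply, Submodule.Quotient.mk_eq_zero]
      exact Submodule.mem_span_singleton_self a
    simp only [v, LinearMap.comp_apply, this, map_zero]
  have hvD : ∀ z ∈ D, z = 0 ∨ 0 < v z := by
    intro z hz
    induction hz using Submodule.span_induction with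
    | mem z hz => exact Or.inr (hu _ ⟨z, hz, rfl⟩)
    | zero => exact Or.inl rfl
    | add x y _ _ hx hy =>
      rcases hx with rfl | hx
      · rwa [zero_add]
      · rcases hy with rfl | hy
        · rw [add_zero]; exact Or.inr hx
        · rw [map_add]; exact Or.inr (add_pos hx hy)
    | smul c x _ hx =>
      rcases hx with rfl | hx
      · exact Or.inl (smul_zero c)
      · rcases eq_or_ne c 0 with rfl | hc
        · exact Or.inl (zero_smul _ x)
        · refine Or.inr ?_
          rw [NNReal.smul_def, map_smul, smul_eq_mul]
          exact mul_pos (NNReal.coe_pos.2 (pos_iff_ne_zero.2 hc)) hx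
  have hdecomp : ∀ x ∈ C, ∃ c : ℝ, ∃ z ∈ D, x = c • a + z := by
    intro x hx
    rw [hC, ← Finset.insert_erase ha, Finset.coe_insert] at hx
    obtain ⟨c, z, hz, rfl⟩ := Submodule.mem_span_insert.1 hx
    exact ⟨c, z, hz, rfl⟩
  refine ⟨_, ⟨v, fun x hx => ?_, rfl⟩, ⟨haC, hva⟩, ?_⟩
  · obtain ⟨c, z, hz, rfl⟩ := hdecomp x hx
    rw [map_add, map_smul, hva, smul_zero, zero_add]
    rcases hvD z hz with rfl | h
    · rw [map_zero]
    · exact h.le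
  · rintro x ⟨hx, hx0⟩
    obtain ⟨c, z, hz, rfl⟩ := hdecomp x hx
    have hvz : v z = 0 := by simpa [hva] using hx0
    rcases hvD z hz with rfl | h
    · rw [add_zero]
      exact Submodule.smul_mem _ c (Submodule.mem_span_singleton_self a)
    · exact absurd hvz h.ne'

/-- An `R`-linear form on `W` extends to an `ℝ`-linear form on `V`. -/
lemma exists_dual_extension {V : Type*} [AddCommGroup V] [Module ℝ V]
    {R : Type*} [CommRing R] [Algebra R ℝ] [Module R V] [IsScalarTower R ℝ V]
    (N : Submodule ℤ V) (hN : IsZStructure N)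
    (W : Submodule R V) (hWN : W = Submodule.span R (N : Set V)) (m : Module.Dual R W) :
    ∃ M : Module.Dual ℝ V, ∀ w : W, M w = algebraMap R ℝ (m w) := by
  have hNW : ∀ x ∈ N, x ∈ W := fun x hx => hWN ▸ Submodule.subset_span hx
  let m' : N →+ ℝ :=
    { toFun := fun x => algebraMap R ℝ (m ⟨x, hNW x x.2⟩)
      map_zero' := by
        have : (⟨((0 : N) : V), hNW _ (0 : N).2⟩ : W) = 0 := rfl
        rw [this]; simp
      map_add' := fun x y => by
        rw [← map_add, ← map_add]; rfl }
  let e := LinearEquiv.ofBijective _ hN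
  let M : Module.Dual ℝ V := (m'.toIntLinearMap.liftBaseChange ℝ) ∘ₗ (e.symm : V →ₗ[ℝ] _)
  have hM : ∀ x (hx : x ∈ N), M x = algebraMap R ℝ (m ⟨x, hNW x hx⟩) := by
    intro x hx
    have he : e.symm x = (1 : ℝ) ⊗ₜ[ℤ] (⟨x, hx⟩ : N) := by
      rw [LinearEquiv.symm_apply_eq]
      change x = N.subtype.liftBaseChange ℝ ((1 : ℝ) ⊗ₜ[ℤ] (⟨x, hx⟩ : N))
      rw [LinearMap.liftBaseChange_tmul, one_smul]
      rfl
    simp [M, he, m']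
  refine ⟨M, ?_⟩
  rintro ⟨w, hw⟩
  subst hWN
  induction hw using Submodule.span_induction with
  | mem x hx => exact hM x hx
  | zero =>
    have : m ⟨0, Submodule.zero_mem _⟩ = 0 := map_zero m
    simp [this]
  | add x y hx hy h1 h2 =>
    have : m ⟨x + y, Submodule.add_mem _ hx hy⟩ = m ⟨x, hx⟩ + m ⟨y, hy⟩ := by
      rw [← map_add]; rfl
    simp only at h1 h2 ⊢
    rw [this, map_add, map_add, h1, h2]
  | smul r x hx h1 =>
    have : m ⟨r • x, Submodule.smul_mem _ r hx⟩ = r • m ⟨x, hx⟩ := by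
      rw [← map_smul]; rfl
    simp only at h1 ⊢
    rw [this, ← algebraMap_smul ℝ r x, map_smul, h1, smul_eq_mul, smul_eq_mul, map_mul]

lemma aQ_mem_ASubmod_iff {V : Type*} [AddCommGroup V] [Module ℝ V]
    {R : Type*} [CommRing R] [Module R V] (W : Submodule R V) (F : Set (Set V)) (hF : F.Finite)
    (g : ↥(raysOf F) → W) (σ : Set V) (r : ↥(raysOf F) → R) :
    aQ W g r ∈ ASubmod W F g σ ↔
      ∃ m : Module.Dual R W, ∀ ρ : ↥(raysOf F), IsFaceOf (ρ : Set V) σ → m (g ρ) = r ρ := by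
  have : Finite ↥(raysOf F) := (hF.subset fun _ h => h.1).to_subtype
  have := Fintype.ofFinite ↥(raysOf F)
  constructor
  · intro h
    let T : Submodule R (↥(raysOf F) → R) :=
      Submodule.pi {ρ | IsFaceOf (ρ : Set V) σ} fun _ => ⊥
    have hT : ASubmod W F g σ ≤ T.map (aQ W g) := by
      refine Submodule.span_le.2 ?_
      rintro _ ⟨ρ, hρ, rfl⟩
      refine Submodule.mem_map_of_mem fun ρ' hρ' => ?_
      have : ρ' ≠ ρ := fun h => hρ (h ▸ hρ')
      simp [this]
    obtain ⟨t, ht, hrt⟩ := hT h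
    obtain ⟨m, hm⟩ := (Submodule.Quotient.eq _).1 hrt.symm
    refine ⟨m, fun ρ hρ => ?_⟩
    have h1 : t ρ = 0 := by simpa using ht ρ hρ
    have h2 := congrFun hm ρ
    simpa [evalFam, h1] using h2
  · rintro ⟨m, hm⟩
    have h1 : aQ W g r = aQ W g (r - evalFam g m) := by
      refine (Submodule.Quotient.eq _).2 ⟨m, ?_⟩
      simp
    rw [h1, pi_eq_sum_univ' (r - evalFam g m), map_sum]
    refine Submodule.sum_mem _ fun ρ _ => ?_
    rw [map_smul]
    by_cases hρ : IsFaceOf (ρ : Set V) σ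
    · have : (r - evalFam g m) ρ = 0 := by simp [evalFam, hm ρ hρ]
      simp [this]
    · refine Submodule.smul_mem _ _ (Submodule.subset_span ⟨ρ, hρ, ?_⟩)
      unfold alphaA
      congr 1
      ext i
      simp [Pi.single_apply, eq_comm]

/-- Linear forms that vanish on the generators of all rays of a cone of a fan vanish on
the cone. -/
lemma eq_zero_of_eq_zero_on_rays {V : Type*} [AddCommGroup V] [Module ℝ V]
    [FiniteDimensional ℝ V] (N : Submodule ℤ V) (F : Set (Set V)) (hF : IsFan N F)
    (g : ↥(raysOf F) → V) (hg : ∀ ρ : ↥(raysOf F), g ρ ∈ (ρ : Set V) ∧ g ρ ≠ 0)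
    {τ : Set V} (hτ : τ ∈ F) (M : Module.Dual ℝ V)
    (hM : ∀ ρ : ↥(raysOf F), IsFaceOf (ρ : Set V) τ → M (g ρ) = 0) :
    ∀ x ∈ τ, M x = 0 := by
  obtain ⟨-, hcone, -, hface⟩ := hF
  obtain ⟨⟨A, -, rfl⟩, hsharp⟩ := hcone τ hτ
  obtain ⟨B, hAB, hB⟩ := exists_generators_of_sharp A hsharp
  have hMB : ∀ a ∈ B, M a = 0 := by
    intro a ha
    obtain ⟨ha0, ρ, hρ, haρ, hρa⟩ := hB a ha
    have hspan : Submodule.span ℝ ρ = Submodule.span ℝ {a} :=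
      le_antisymm (Submodule.span_le.2 hρa) (Submodule.span_mono (by simpa using haρ))
    have hray : ρ ∈ raysOf F :=
      ⟨hface _ hτ ρ hρ, by rw [hspan]; exact finrank_span_singleton ha0⟩
    obtain ⟨s, hsa⟩ := Submodule.mem_span_singleton.1 (hρa (hg ⟨ρ, hray⟩).1)
    have h0 := hM ⟨ρ, hray⟩ hρ
    have hs0 : s ≠ 0 := by
      rintro rfl
      exact (hg ⟨ρ, hray⟩).2 (by rw [← hsa, zero_smul])
    rw [← hsa, map_smul, smul_eq_mul] at h0
    exact (mul_eq_zero.1 h0).resolve_left hs0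
  intro x hx
  rw [hAB] at hx
  obtain ⟨s, c, hs, -, rfl⟩ := hx
  rw [map_sum]
  exact Finset.sum_eq_zero fun v hv => by rw [map_smul, hMB v (hs hv), smul_zero]

/-- Under the canonical embedding `b_{W,Σ}`, the Picard module satisfies
`Pic_W(Σ) = ⋂_{σ∈Σ} A^σ_{W,Σ}` as sub-`R`-modules of `A_{W,Σ₁}`. -/
theorem picInA_eq_iInf_ASubmod
    {V : Type*} [AddCommGroup V] [Module ℝ V] [FiniteDimensional ℝ V]
    {R : Type*} [CommRing R] [IsDomain R] [IsPrincipalIdealRing R]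
    [Algebra R ℝ] (hinj : Function.Injective (algebraMap R ℝ))
    [Module R V] [IsScalarTower R ℝ V]
    (N : Submodule ℤ V) (hN : IsZStructure N)
    (W : Submodule R V) (hWN : W = Submodule.span R (N : Set V))
    (F : Set (Set V)) (hF : IsFan N F)
    (g : ↥(raysOf F) → W) (hg : ∀ ρ : ↥(raysOf F), IsMinGen N (ρ : Set V) ((g ρ : W) : V)) :
    picInA W F g = ⨅ σ ∈ F, ASubmod W F g σ := by
  have key : ∀ m ∈ goodFam W F, ∀ σ (hσ : σ ∈ F) (ρ : ↥(raysOf F)), IsFaceOf (ρ : Set V) σ →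
      m ⟨σ, hσ⟩ (g ρ) = dFam W F g m ρ := by
    intro m hm σ hσ ρ hρ
    have h1 := hm ⟨σ, hσ⟩ ⟨ρ, ρ.2.1⟩ hρ (g ρ) (hg ρ).2.1
    rw [LinearMap.sub_apply, sub_eq_zero] at h1
    exact h1
  apply le_antisymm
  · rintro _ ⟨m, hm, rfl⟩
    simp only [Submodule.mem_iInf]
    intro σ hσ
    exact (aQ_mem_ASubmod_iff W F hF.1 g σ _).2 ⟨m ⟨σ, hσ⟩, key m hm σ hσ⟩
  · intro x hx
    obtain ⟨r, rfl⟩ := Submodule.mkQ_surjective _ x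
    simp only [Submodule.mem_iInf] at hx
    choose m hm using fun σ : ↥F => (aQ_mem_ASubmod_iff W F hF.1 g σ r).1 (hx σ σ.2)
    refine ⟨m, ?_, ?_⟩
    · intro σ τ hτσ w hw
      obtain ⟨M, hM⟩ := exists_dual_extension N hN W hWN (m σ - m τ)
      apply hinj
      rw [map_zero, ← hM]
      refine eq_zero_of_eq_zero_on_rays N F hF (fun ρ : ↥(raysOf F) => (g ρ : V))
        (fun ρ => ⟨(hg ρ).2.1, (hg ρ).2.2.1⟩) τ.2 M (fun ρ hρ => ?_) w hw
      have hρσ : IsFaceOf (ρ : Set V) (σ : Set V) := by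
        have hsub : (ρ : Set V) ⊆ σ := by
          obtain ⟨u, -, hu⟩ := hρ
          obtain ⟨v, -, hv⟩ := hτσ
          rw [hu, hv]
          exact fun x hx => hx.1.1
        have := hF.2.2.1 σ σ.2 ρ ρ.2.1
        rwa [Set.inter_eq_self_of_subset_right hsub] at this
      rw [hM, LinearMap.sub_apply, hm σ ρ hρσ, hm τ ρ hρ, sub_self, map_zero]
    · change aQ W g (dFam W F g m) = aQ W g r
      congr 1
      ext ρ
      exact hm ⟨ρ, ρ.2.1⟩ ρ ⟨0, by simp, by simp⟩

end ToricStmt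
end
end

section
/- Let F ⊆ G be a subgroup, let M be a G-graded R-module, and let N ⊆ M_(F) be a graded sub-R_(F)-module. Then N = ⟨N⟩_R ∩ M_(F), where ⟨N⟩_R denotes the sub-R-module of M generated by N. -/
/-- The components of an element of `⨆ g ∈ F, ℳ g` in degrees outside `F` vanish. -/
theorem DirectSum.decompose_eq_zero_of_mem_biSup
    {G M : Type*} [DecidableEq G] [AddCommGroup M] (ℳ : G → AddSubgroup M)
    [DirectSum.Decomposition ℳ] (F : Set G) {x : M}
    (hx : x ∈ (⨆ g ∈ F, ℳ g : AddSubgroup M)) {j : G} (hj : j ∉ F) :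
    ((DirectSum.decompose ℳ x) j : M) = 0 := by
  have hle : (⨆ g ∈ F, ℳ g : AddSubgroup M) ≤
      ((DFinsupp.evalAddMonoidHom j).comp
        (DirectSum.decomposeAddEquiv ℳ).toAddMonoidHom).ker := by
    refine iSup₂_le fun g hg y hy => ?_
    have hgj : g ≠ j := fun h => hj (h ▸ hg)
    exact Subtype.ext (DirectSum.decompose_of_mem_ne ℳ hy hgj)
  exact congrArg Subtype.val (AddMonoidHom.mem_ker.mp (hle hx))

/-- The components in degrees in `F` of an `R`-multiple of an element of a graded
sub-`R_(F)`-module `N` lie in `N`. -/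
theorem decompose_smul_mem_of_mem
    {G : Type*} [AddCommGroup G] [DecidableEq G]
    {R : Type*} [CommRing R] (𝒜 : G → AddSubgroup R) [GradedRing 𝒜]
    {M : Type*} [AddCommGroup M] [Module R M]
    (ℳ : G → AddSubgroup M) [SetLike.GradedSMul 𝒜 ℳ] [DirectSum.Decomposition ℳ]
    (F : AddSubgroup G) (N : AddSubgroup M)
    (hN₁ : N ≤ ⨆ g ∈ F, ℳ g)
    (hN₂ : ∀ r ∈ (⨆ g ∈ F, 𝒜 g : AddSubgroup R), ∀ x ∈ N, r • x ∈ N)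
    (hN₃ : ∀ x ∈ N, ∀ g : G, ((DirectSum.decompose ℳ x) g : M) ∈ N)
    (r : R) {x : M} (hx : x ∈ N) {g : G} (hg : g ∈ F) :
    ((DirectSum.decompose ℳ (r • x)) g : M) ∈ N := by
  classical
  induction r using DirectSum.Decomposition.inductionOn 𝒜 with
  | zero => simp
  | add a b ha hb =>
    rw [add_smul, DirectSum.decompose_add, DirectSum.add_apply, AddSubgroup.coe_add]
    exact N.add_mem ha hb
  | @homogeneous i a =>
    rw [← DirectSum.sum_support_decompose ℳ x, Finset.smul_sum, DirectSum.decompose_sum,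
      DFinsupp.finsetSum_apply, AddSubgroup.val_finsetSum]
    refine N.sum_mem fun j _ => ?_
    have hmem : (a : R) • ((DirectSum.decompose ℳ x) j : M) ∈ ℳ (i + j) :=
      SetLike.GradedSMul.smul_mem (A := 𝒜) (B := ℳ) a.2 (SetLike.coe_mem _)
    by_cases hij : i + j = g
    · subst hij
      rw [DirectSum.decompose_of_mem_same ℳ hmem]
      by_cases hj : j ∈ F
      · have hi : i ∈ F := (F.add_mem_cancel_right hj).mp hg
        exact hN₂ _ (AddSubgroup.mem_iSup_of_mem i (AddSubgroup.mem_iSup_of_mem hi a.2)) _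
          (hN₃ x hx j)
      · rw [DirectSum.decompose_eq_zero_of_mem_biSup ℳ (F : Set G) (hN₁ hx) hj, smul_zero]
        exact N.zero_mem
    · rw [DirectSum.decompose_of_mem_ne ℳ hmem hij]
      exact N.zero_mem

/-- Let `R` be a `G`-graded ring, `F ⊆ G` a subgroup, `M` a `G`-graded
`R`-module, and `N ⊆ M_(F)` a graded sub-`R_(F)`-module. Then `N = ⟨N⟩_R ∩ M_(F)`, where
`⟨N⟩_R` is the sub-`R`-module of `M` generated by `N`. -/
theorem gradedSubmodule_eq_span_inter_restriction
    {G : Type*} [AddCommGroup G] [DecidableEq G]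
    {R : Type*} [CommRing R] (𝒜 : G → AddSubgroup R) [GradedRing 𝒜]
    {M : Type*} [AddCommGroup M] [Module R M]
    (ℳ : G → AddSubgroup M) [SetLike.GradedSMul 𝒜 ℳ] [DirectSum.Decomposition ℳ]
    (F : AddSubgroup G) (N : AddSubgroup M)
    (hN₁ : N ≤ ⨆ g ∈ F, ℳ g)
    (hN₂ : ∀ r ∈ (⨆ g ∈ F, 𝒜 g : AddSubgroup R), ∀ x ∈ N, r • x ∈ N)
    (hN₃ : ∀ x ∈ N, ∀ g : G, ((DirectSum.decompose ℳ x) g : M) ∈ N) :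
    (N : Set M) = ↑(Submodule.span R (N : Set M)) ∩ ↑(⨆ g ∈ F, ℳ g : AddSubgroup M) := by
  classical
  refine Set.Subset.antisymm (fun x hx => ⟨Submodule.subset_span hx, hN₁ hx⟩) ?_
  rintro y ⟨hy, hyF⟩
  have hcomp : ∀ g ∈ F, ((DirectSum.decompose ℳ y) g : M) ∈ N := by
    clear hyF
    intro g hg
    induction hy using Submodule.closure_induction with
    | zero => simp
    | add a b _ _ ha hb =>
      rw [DirectSum.decompose_add, DirectSum.add_apply, AddSubgroup.coe_add]
      exact N.add_mem ha hb
    | smul_mem r x hx => exact decompose_smul_mem_of_mem 𝒜 ℳ F N hN₁ hN₂ hN₃ r hx hg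
  rw [SetLike.mem_coe, ← DirectSum.sum_support_decompose ℳ y]
  refine N.sum_mem fun g _ => ?_
  by_cases hg : g ∈ F
  · exact hcomp g hg
  · rw [DirectSum.decompose_eq_zero_of_mem_biSup ℳ (F : Set G) hyF hg]
    exact N.zero_mem
end

section
/- Let F ⊆ G be a subgroup and let M be a noetherian G-graded R-module. Then: a) the F-graded R_(F)-module M_(F) is noetherian; b) for every g ∈ G the R_0-module M_g is noetherian. -/
open DirectSum

/-- The projection of a graded group onto the sum of the components with degrees in `C`. -/
noncomputable def gradedProj {G N : Type*} [DecidableEq G] [AddCommGroup N]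
    (ℳ : G → AddSubgroup N) [Decomposition ℳ] (C : Set G) : N →+ N :=
  haveI := Classical.decPred (· ∈ C)
  (DirectSum.toAddMonoid fun g => if g ∈ C then (ℳ g).subtype else 0).comp
    (decomposeAddEquiv ℳ).toAddMonoidHom

section gradedProj

variable {G N : Type*} [DecidableEq G] [AddCommGroup N]
  (ℳ : G → AddSubgroup N) [Decomposition ℳ] (C : Set G)

lemma gradedProj_of_mem {g : G} (hg : g ∈ C) {x : N} (hx : x ∈ ℳ g) :
    gradedProj ℳ C x = x := by
  simp [gradedProj, decompose_of_mem ℳ hx, hg]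

lemma gradedProj_of_notMem {g : G} (hg : g ∉ C) {x : N} (hx : x ∈ ℳ g) :
    gradedProj ℳ C x = 0 := by
  simp [gradedProj, decompose_of_mem ℳ hx, hg]

lemma gradedProj_mem (x : N) : gradedProj ℳ C x ∈ ⨆ g ∈ C, ℳ g := by
  induction x using Decomposition.inductionOn ℳ with
  | zero => simp
  | @homogeneous i m =>
    by_cases hi : i ∈ C
    · rw [gradedProj_of_mem ℳ C hi m.2]
      exact AddSubgroup.mem_iSup_of_mem i (AddSubgroup.mem_iSup_of_mem hi m.2)
    · rw [gradedProj_of_notMem ℳ C hi m.2]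
      exact zero_mem _
  | add a b ha hb => simpa using add_mem ha hb

lemma gradedProj_eq_self {x : N} (hx : x ∈ ⨆ g ∈ C, ℳ g) : gradedProj ℳ C x = x := by
  have h : (⨆ g ∈ C, ℳ g) ≤ (gradedProj ℳ C).eqLocus (AddMonoidHom.id N) :=
    iSup₂_le fun _ hg _ hx => gradedProj_of_mem ℳ C hg hx
  exact h hx

end gradedProj

lemma decompose_mem_span {G : Type*} [AddCommGroup G] [DecidableEq G]
    {R : Type*} [CommRing R] (𝒜 : G → AddSubgroup R) [GradedRing 𝒜]
    {M : Type*} [AddCommGroup M] [Module R M]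
    (ℳ : G → AddSubgroup M) [SetLike.GradedSMul 𝒜 ℳ] [Decomposition ℳ]
    {P : Set M} (hP : ∀ x ∈ P, ∀ g, (decompose ℳ x g : M) ∈ P)
    {x : M} (hx : x ∈ Submodule.span R P) (g : G) :
    (decompose ℳ x g : M) ∈ Submodule.span R P := by
  classical
  have key (g : G) (a : R) {y : M} (hy : ∀ h, (decompose ℳ y h : M) ∈ Submodule.span R P) :
      (decompose ℳ (a • y) g : M) ∈ Submodule.span R P := by
    induction a using Decomposition.inductionOn 𝒜 with
    | zero => simp
    | @homogeneous i a =>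
      rw [← sum_support_decompose ℳ y, Finset.smul_sum, decompose_sum, DFinsupp.finsetSum_apply,
        AddSubgroup.val_finsetSum]
      refine sum_mem fun j _ => ?_
      have haj : (a : R) • (decompose ℳ y j : M) ∈ ℳ (i + j) :=
        SetLike.GradedSMul.smul_mem a.2 (decompose ℳ y j).2
      by_cases hg : i + j = g
      · subst hg
        rw [decompose_of_mem_same ℳ haj]
        exact Submodule.smul_mem _ _ (hy j)
      · rw [decompose_of_mem_ne ℳ haj hg]
        exact zero_mem _
    | add a b ha hb => simpa [add_smul] using add_mem ha hb
  induction hx using Submodule.span_induction generalizing g with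
  | mem x hx => exact Submodule.subset_span (hP x hx g)
  | zero => simp
  | add x y _ _ hx hy => simpa using add_mem (hx g) (hy g)
  | smul a x _ hx => exact key g a hx

section GradedModule

variable {G : Type*} [AddCommGroup G] [DecidableEq G]
  {R : Type*} [CommRing R] (𝒜 : G → AddSubgroup R) [GradedRing 𝒜]
  {M : Type*} [AddCommGroup M] [Module R M]
  (ℳ : G → AddSubgroup M) [SetLike.GradedSMul 𝒜 ℳ] [Decomposition ℳ]

lemma gradedProj_smul {F C : Set G} (hC : ∀ i, ∀ j ∈ C, i + j ∈ C ↔ i ∈ F) (r : R) {m : M}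
    (hm : m ∈ ⨆ g ∈ C, ℳ g) : gradedProj ℳ C (r • m) = gradedProj 𝒜 F r • m := by
  induction r using Decomposition.inductionOn 𝒜 with
  | zero => simp
  | @homogeneous i a =>
    have h : (⨆ g ∈ C, ℳ g) ≤
        ((gradedProj ℳ C).comp (DistribSMul.toAddMonoidHom M (a : R))).eqLocus
          (DistribSMul.toAddMonoidHom M (gradedProj 𝒜 F (a : R))) := by
      refine iSup₂_le fun j hj x hx => ?_
      have hax : (a : R) • x ∈ ℳ (i + j) := SetLike.GradedSMul.smul_mem a.2 hx
      change gradedProj ℳ C ((a : R) • x) = gradedProj 𝒜 F (a : R) • x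
      by_cases hi : i ∈ F
      · rw [gradedProj_of_mem ℳ C ((hC i j hj).2 hi) hax, gradedProj_of_mem 𝒜 F hi a.2]
      · rw [gradedProj_of_notMem ℳ C (mt (hC i j hj).1 hi) hax,
          gradedProj_of_notMem 𝒜 F hi a.2, zero_smul]
    exact h hm
  | add a b ha hb => rw [add_smul, map_add, ha, hb, map_add, add_smul]

/-- If `i + j ∈ C ↔ i ∈ F` for `j ∈ C` (for instance, `C` is a coset of a subgroup `F`) and `M` is
noetherian as a graded module, then graded `R_(F)`-submodules of `M_(C)` are finitely generated. -/
lemma exists_finset_generating_of_le_iSup {F C : Set G}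
    (hC : ∀ i, ∀ j ∈ C, i + j ∈ C ↔ i ∈ F)
    (hnoeth : ∀ p : Submodule R M, (∀ x ∈ p, ∀ g, (decompose ℳ x g : M) ∈ p) → p.FG)
    (P : AddSubgroup M) (hPC : P ≤ ⨆ g ∈ C, ℳ g)
    (hP : ∀ x ∈ P, ∀ g, (decompose ℳ x g : M) ∈ P) :
    ∃ S : Finset M, ↑S ⊆ (P : Set M) ∧
      ∀ Q : AddSubgroup M, ↑S ⊆ (Q : Set M) →
        (∀ r ∈ (⨆ g ∈ F, 𝒜 g : AddSubgroup R), ∀ x ∈ Q, r • x ∈ Q) → P ≤ Q := by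
  obtain ⟨S, hSP, hS⟩ := (Submodule.fg_span_iff_fg_span_finset_subset (P : Set M)).1
    (hnoeth (Submodule.span R P) fun x hx g => decompose_mem_span 𝒜 ℳ hP hx g)
  refine ⟨S, hSP, fun Q hSQ hQ x hx => ?_⟩
  have key {y : M} (hy : y ∈ Submodule.span R (S : Set M)) :
      ∀ r : R, gradedProj ℳ C (r • y) ∈ Q := by
    induction hy using Submodule.span_induction with
    | mem y hy =>
      intro r
      rw [gradedProj_smul 𝒜 ℳ hC r (hPC (hSP hy))]
      exact hQ _ (gradedProj_mem 𝒜 F r) _ (hSQ hy)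
    | zero => simp
    | add y z _ _ hy hz => exact fun r => by simpa using add_mem (hy r) (hz r)
    | smul a y _ hy => exact fun r => by simpa [smul_smul] using hy (r * a)
  have hxS : x ∈ Submodule.span R (S : Set M) := hS ▸ Submodule.subset_span hx
  simpa [gradedProj_eq_self ℳ C (hPC hx)] using key hxS 1

end GradedModule

/-- Let `R` be a `G`-graded ring, `F ⊆ G` a subgroup and `M` a
noetherian `G`-graded `R`-module. Then a) the `F`-graded `R_(F)`-module `M_(F)` is
noetherian (every graded `R_(F)`-submodule of `M_(F)` is finitely generated over
`R_(F)`), and b) for every `g ∈ G` the `R_0`-module `M_g` is noetherian (every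
`R_0`-submodule of `M_g` is finitely generated over `R_0`). -/
theorem restriction_noetherian_of_noetherian
    {G : Type*} [AddCommGroup G] [DecidableEq G]
    {R : Type*} [CommRing R] (𝒜 : G → AddSubgroup R) [GradedRing 𝒜]
    {M : Type*} [AddCommGroup M] [Module R M]
    (ℳ : G → AddSubgroup M) [SetLike.GradedSMul 𝒜 ℳ] [DirectSum.Decomposition ℳ]
    (F : AddSubgroup G)
    (hnoeth : ∀ p : Submodule R M,
      (∀ x ∈ p, ∀ g : G, ((DirectSum.decompose ℳ x) g : M) ∈ p) → p.FG) :
    ((∀ P : AddSubgroup M, P ≤ ⨆ g ∈ F, ℳ g →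
        (∀ r ∈ (⨆ g ∈ F, 𝒜 g : AddSubgroup R), ∀ x ∈ P, r • x ∈ P) →
        (∀ x ∈ P, ∀ g : G, ((DirectSum.decompose ℳ x) g : M) ∈ P) →
        ∃ S : Finset M, ↑S ⊆ (P : Set M) ∧
          ∀ Q : AddSubgroup M, ↑S ⊆ (Q : Set M) →
            (∀ r ∈ (⨆ g ∈ F, 𝒜 g : AddSubgroup R), ∀ x ∈ Q, r • x ∈ Q) → P ≤ Q) ∧
      (∀ g : G, ∀ P : AddSubgroup M, P ≤ ℳ g →
        (∀ r ∈ 𝒜 (0 : G), ∀ x ∈ P, r • x ∈ P) →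
        ∃ S : Finset M, ↑S ⊆ (P : Set M) ∧
          ∀ Q : AddSubgroup M, ↑S ⊆ (Q : Set M) →
            (∀ r ∈ 𝒜 (0 : G), ∀ x ∈ Q, r • x ∈ Q) → P ≤ Q)) := by
  refine ⟨fun P hPF _ hP => ?_, fun g P hPg _ => ?_⟩
  · exact exists_finset_generating_of_le_iSup 𝒜 ℳ (F := F) (C := F)
      (fun i j hj => F.add_mem_cancel_right hj) hnoeth P hPF hP
  · obtain ⟨S, hSP, hS⟩ := exists_finset_generating_of_le_iSup 𝒜 ℳ (F := {0}) (C := {g})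
      (by simp) hnoeth P (by simpa using hPg) fun x hx h => by
        by_cases hgh : g = h
        · subst hgh
          rwa [decompose_of_mem_same ℳ (hPg hx)]
        · rw [decompose_of_mem_ne ℳ (hPg hx) hgh]
          exact zero_mem _
    exact ⟨S, hSP, fun Q hSQ hQ => hS Q hSQ (by simpa using hQ)⟩
end

section
/- Let R be positively G-graded and let (x_i)_{i∈I} be a family of homogeneous elements of R of nonzero degree. Consider the statements: (1) for every g ∈ G, the R_0-module R_g is generated by the products ∏_{i∈I} x_i^{n_i} (with (n_i)_{i∈I} finitely supported in ℕ) whose degree is g; (2) R = R_0[x_i : i ∈ I]; (3) R_+ is generated as an ideal of R by {x_i : i ∈ I}. Then (1) and (2) are equivalent and imply (3), and if degmon(R) is artinian then (1), (2) and (3) are equivalent. -/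
/-- The degree monoid of a `G`-graded ring: the submonoid of `G` generated by the degrees
`g` with `R_g ≠ 0`. -/
def degreeMonoid {G : Type*} [AddCommGroup G] {R : Type*} [CommRing R]
    (𝒜 : G → AddSubgroup R) : AddSubmonoid G :=
  AddSubmonoid.closure {g : G | ∃ r : R, r ≠ 0 ∧ r ∈ 𝒜 g}

open DirectSum

section MonomialSpan

variable {G : Type*} [AddCommGroup G] {R : Type*} [CommRing R]

/-- The additive subgroup generated by the `R_0`-multiples of the monomials of degree `g` in the
family `x`, where `x i` is given degree `d i`. -/
def monomialSpan (𝒜 : G → AddSubgroup R) {I : Type*} (x : I → R) (d : I → G) (g : G) :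
    AddSubgroup R :=
  AddSubgroup.closure
    {y : R | ∃ (a : R) (n : I →₀ ℕ), a ∈ 𝒜 (0 : G) ∧
      (∑ i ∈ n.support, n i • d i) = g ∧ y = a * ∏ i ∈ n.support, x i ^ n i}

theorem mem_degreeMonoid {𝒜 : G → AddSubgroup R} {g : G} {r : R} (hr : r ∈ 𝒜 g) (h : r ≠ 0) :
    g ∈ degreeMonoid 𝒜 :=
  AddSubmonoid.subset_closure ⟨r, h, hr⟩

variable (𝒜 : G → AddSubgroup R) {I : Type*} {x : I → R} {d : I → G}

theorem mem_monomialSpan_zero {a : R} (ha : a ∈ 𝒜 0) : a ∈ monomialSpan 𝒜 x d 0 :=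
  AddSubgroup.subset_closure ⟨a, 0, ha, by simp, by simp⟩

theorem monomialSpan_le_subringClosure (g : G) :
    (monomialSpan 𝒜 x d g : Set R) ⊆ Subring.closure ((𝒜 (0 : G) : Set R) ∪ Set.range x) := by
  refine (AddSubgroup.closure_le
    (Subring.closure ((𝒜 (0 : G) : Set R) ∪ Set.range x)).toAddSubgroup).2 ?_
  rintro _ ⟨a, n, ha, rfl, rfl⟩
  change _ ∈ Subring.closure _
  exact mul_mem (Subring.subset_closure (Set.mem_union_left _ ha))
    (prod_mem fun i _ => pow_mem
      (Subring.subset_closure (Set.mem_union_right _ (Set.mem_range_self i))) _)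

theorem monomialSpan_le_span {g : G} (hg : g ≠ 0) :
    (monomialSpan 𝒜 x d g : Set R) ⊆ Ideal.span (Set.range x) := by
  refine (AddSubgroup.closure_le (Ideal.span (Set.range x)).toAddSubgroup).2 ?_
  rintro _ ⟨a, n, -, rfl, rfl⟩
  change _ ∈ Ideal.span _
  obtain ⟨i, hi, -⟩ := Finset.exists_ne_zero_of_sum_ne_zero hg
  refine Ideal.mul_mem_left _ _ (Ideal.mem_of_dvd _ (Finset.dvd_prod_of_mem _ hi) ?_)
  exact Ideal.pow_mem_of_mem _ (Ideal.subset_span (Set.mem_range_self i)) _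
    (Nat.pos_of_ne_zero (Finsupp.mem_support_iff.1 hi))

variable [DecidableEq G] [GradedRing 𝒜]

theorem mem_degreeMonoid_of_decompose_ne_zero {g : G} {r : R}
    (h : (decompose 𝒜 r g : R) ≠ 0) : g ∈ degreeMonoid 𝒜 :=
  mem_degreeMonoid (decompose 𝒜 r g).2 h

theorem prod_pow_mem_graded (hx : ∀ i, x i ∈ 𝒜 (d i)) (n : I →₀ ℕ) (s : Finset I) :
    ∏ i ∈ s, x i ^ n i ∈ 𝒜 (∑ i ∈ s, n i • d i) :=
  SetLike.prod_mem_graded _ _ _ fun i _ => SetLike.pow_mem_graded (n i) (hx i)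

theorem monomialSpan_le (hx : ∀ i, x i ∈ 𝒜 (d i)) (g : G) : monomialSpan 𝒜 x d g ≤ 𝒜 g := by
  refine (AddSubgroup.closure_le _).2 ?_
  rintro _ ⟨a, n, ha, rfl, rfl⟩
  simpa using SetLike.mul_mem_graded ha (prod_pow_mem_graded 𝒜 hx n n.support)

theorem mem_monomialSpan_self (i : I) : x i ∈ monomialSpan 𝒜 x d (d i) := by
  refine AddSubgroup.subset_closure ⟨1, Finsupp.single i 1, SetLike.one_mem_graded 𝒜, ?_, ?_⟩
  · exact (Finsupp.sum_single_index (h := fun i k => k • d i) (zero_nsmul _)).trans (one_nsmul _)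
  · rw [one_mul]
    exact ((Finsupp.prod_single_index (h := fun i k => x i ^ k) (pow_zero _)).trans
      (pow_one _)).symm

theorem mul_mem_monomialSpan {g h : G} {a b : R} (ha : a ∈ monomialSpan 𝒜 x d g)
    (hb : b ∈ monomialSpan 𝒜 x d h) : a * b ∈ monomialSpan 𝒜 x d (g + h) := by
  induction ha using AddSubgroup.closure_induction with
  | zero => simp
  | add _ _ _ _ h₁ h₂ => rw [add_mul]; exact add_mem h₁ h₂
  | neg _ _ h₁ => rw [neg_mul]; exact neg_mem h₁
  | mem a ha =>
    obtain ⟨a, n, ha, rfl, rfl⟩ := ha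
    induction hb using AddSubgroup.closure_induction with
    | zero => simp
    | add _ _ _ _ h₁ h₂ => rw [mul_add]; exact add_mem h₁ h₂
    | neg _ _ h₁ => rw [mul_neg]; exact neg_mem h₁
    | mem b hb =>
      obtain ⟨b, k, hb, rfl, rfl⟩ := hb
      refine AddSubgroup.subset_closure ⟨a * b, n + k, ?_, ?_, ?_⟩
      · simpa using SetLike.mul_mem_graded ha hb
      · exact Finsupp.sum_add_index' (h := fun i k => k • d i) (fun i => zero_nsmul _)
          fun i => add_nsmul _
      · rw [mul_mul_mul_comm]
        exact congrArg (a * b * ·) (Finsupp.prod_add_index' (h := fun i k => x i ^ k)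
          (fun i => pow_zero _) fun i => pow_add _).symm

theorem decompose_mem_of_mem {M : G → AddSubgroup R} {g : G} {r : R} (hr : r ∈ 𝒜 g)
    (hM : r ∈ M g) (h : G) : (decompose 𝒜 r h : R) ∈ M h := by
  obtain rfl | hgh := eq_or_ne g h
  · rwa [decompose_of_mem_same 𝒜 hr]
  · rw [decompose_of_mem_ne 𝒜 hr hgh]
    exact zero_mem _

/-- The homogeneous components of an element of `R_0[x_i : i ∈ I]` are combinations of
monomials. -/
theorem decompose_mem_monomialSpan (hx : ∀ i, x i ∈ 𝒜 (d i)) {r : R}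
    (hr : r ∈ Subring.closure ((𝒜 (0 : G) : Set R) ∪ Set.range x)) (g : G) :
    (decompose 𝒜 r g : R) ∈ monomialSpan 𝒜 x d g := by
  induction hr using Subring.closure_induction generalizing g with
  | mem r hr =>
    rcases hr with hr | ⟨i, rfl⟩
    · exact decompose_mem_of_mem 𝒜 hr (mem_monomialSpan_zero 𝒜 hr) g
    · exact decompose_mem_of_mem 𝒜 (hx i) (mem_monomialSpan_self 𝒜 i) g
  | zero => simp
  | one =>
    have h1 : (1 : R) ∈ 𝒜 0 := SetLike.one_mem_graded 𝒜
    exact decompose_mem_of_mem 𝒜 h1 (mem_monomialSpan_zero 𝒜 h1) g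
  | add a b _ _ ha hb =>
    rw [decompose_add, DirectSum.add_apply, AddSubgroup.coe_add]
    exact add_mem (ha g) (hb g)
  | neg a _ ha =>
    rw [decompose_neg, DFinsupp.neg_apply, AddSubgroup.coe_neg]
    exact neg_mem (ha g)
  | mul a b _ _ ha hb =>
    classical
    rw [decompose_mul, DirectSum.coe_mul_apply]
    refine sum_mem fun p hp => ?_
    rw [← (Finset.mem_filter.1 hp).2]
    exact mul_mem_monomialSpan 𝒜 (ha _) (hb _)

theorem forall_eq_monomialSpan_iff (hx : ∀ i, x i ∈ 𝒜 (d i)) :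
    (∀ g, 𝒜 g = monomialSpan 𝒜 x d g) ↔
      Subring.closure ((𝒜 (0 : G) : Set R) ∪ Set.range x) = ⊤ := by
  classical
  constructor
  · refine fun h => eq_top_iff.2 fun r _ => ?_
    rw [← sum_support_decompose 𝒜 r]
    refine sum_mem fun g _ => monomialSpan_le_subringClosure (d := d) 𝒜 g ?_
    rw [← h g]
    exact (decompose 𝒜 r g).2
  · refine fun h g => le_antisymm (fun r hr => ?_) (monomialSpan_le 𝒜 hx g)
    rw [← decompose_of_mem_same 𝒜 hr]
    exact decompose_mem_monomialSpan 𝒜 hx (h ▸ Subring.mem_top r) g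

/-- The subgroup `R_+` consists of the elements whose component of degree `0` vanishes. -/
theorem mem_iSup_degreeMonoid_ne_zero_iff {r : R} :
    r ∈ (⨆ g ∈ {h : G | h ∈ degreeMonoid 𝒜 ∧ h ≠ 0}, 𝒜 g : AddSubgroup R) ↔
      (decompose 𝒜 r 0 : R) = 0 := by
  classical
  constructor
  · intro hr
    suffices h : (⨆ g ∈ {h : G | h ∈ degreeMonoid 𝒜 ∧ h ≠ 0}, 𝒜 g : AddSubgroup R) ≤
        (GradedRing.proj 𝒜 0).ker from h hr
    exact iSup₂_le fun g hg s hs => decompose_of_mem_ne 𝒜 hs hg.2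
  · intro h0
    rw [← sum_support_decompose 𝒜 r]
    refine sum_mem fun g hg => ?_
    have hg' : (decompose 𝒜 r g : R) ≠ 0 := by simpa using hg
    have hmem : g ∈ {h : G | h ∈ degreeMonoid 𝒜 ∧ h ≠ 0} :=
      ⟨mem_degreeMonoid_of_decompose_ne_zero 𝒜 hg', by rintro rfl; exact hg' h0⟩
    exact le_iSup₂ (f := fun g (_ : g ∈ {h : G | h ∈ degreeMonoid 𝒜 ∧ h ≠ 0}) => 𝒜 g) g hmem
      (decompose 𝒜 r g).2

theorem decompose_mul_zero_eq_zero
    (hpos : ∀ g ∈ degreeMonoid 𝒜, -g ∈ degreeMonoid 𝒜 → g = 0)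
    (r : R) {s : R} (hs : (decompose 𝒜 s 0 : R) = 0) :
    (decompose 𝒜 (r * s) 0 : R) = 0 := by
  classical
  rw [decompose_mul, DirectSum.coe_mul_apply]
  refine Finset.sum_eq_zero fun p hp => ?_
  by_contra h
  have h₁ := mem_degreeMonoid_of_decompose_ne_zero 𝒜 (left_ne_zero_of_mul h)
  have h₂ := mem_degreeMonoid_of_decompose_ne_zero 𝒜 (right_ne_zero_of_mul h)
  have hp0 := (Finset.mem_filter.1 hp).2
  have h20 : p.2 = 0 := hpos _ h₂ (by rwa [← eq_neg_of_add_eq_zero_left hp0])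
  rw [h20, hs, mul_zero] at h
  exact h rfl

theorem decompose_zero_of_mem_span
    (hpos : ∀ g ∈ degreeMonoid 𝒜, -g ∈ degreeMonoid 𝒜 → g = 0)
    (hx : ∀ i, x i ∈ 𝒜 (d i)) (hd : ∀ i, d i ≠ 0) {r : R}
    (hr : r ∈ Ideal.span (Set.range x)) : (decompose 𝒜 r 0 : R) = 0 := by
  induction hr using Submodule.span_induction with
  | mem r hr =>
    obtain ⟨i, rfl⟩ := hr
    exact decompose_of_mem_ne 𝒜 (hx i) (hd i)
  | zero => simp
  | add a b _ _ ha hb => rw [decompose_add, DirectSum.add_apply, AddSubgroup.coe_add, ha, hb,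
      add_zero]
  | smul a b _ hb => exact decompose_mul_zero_eq_zero 𝒜 hpos a hb

theorem iSup_eq_span_of_forall_eq_monomialSpan
    (hpos : ∀ g ∈ degreeMonoid 𝒜, -g ∈ degreeMonoid 𝒜 → g = 0)
    (hx : ∀ i, x i ∈ 𝒜 (d i)) (hd : ∀ i, d i ≠ 0)
    (h : ∀ g, 𝒜 g = monomialSpan 𝒜 x d g) :
    ((⨆ g ∈ {h : G | h ∈ degreeMonoid 𝒜 ∧ h ≠ 0}, 𝒜 g : AddSubgroup R) : Set R) =
      ↑(Ideal.span (Set.range x)) := by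
  refine Set.Subset.antisymm ?_ fun r hr => (mem_iSup_degreeMonoid_ne_zero_iff 𝒜).2
    (decompose_zero_of_mem_span 𝒜 hpos hx hd hr)
  suffices hle : (⨆ g ∈ {h : G | h ∈ degreeMonoid 𝒜 ∧ h ≠ 0}, 𝒜 g : AddSubgroup R) ≤
      (Ideal.span (Set.range x)).toAddSubgroup from hle
  refine iSup₂_le fun g hg r hr => monomialSpan_le_span (d := d) 𝒜 hg.2 ?_
  rwa [← h g]

theorem forall_eq_monomialSpan_of_iSup_eq_span
    (hpos : ∀ g ∈ degreeMonoid 𝒜, -g ∈ degreeMonoid 𝒜 → g = 0)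
    (hx : ∀ i, x i ∈ 𝒜 (d i)) (hd : ∀ i, d i ≠ 0)
    (hart : ∀ T : Set G, T ⊆ (degreeMonoid 𝒜 : Set G) → T.Nonempty →
      ∃ m ∈ T, ∀ t ∈ T, (∃ s ∈ degreeMonoid 𝒜, m = t + s) → ∃ s ∈ degreeMonoid 𝒜, t = m + s)
    (h : ((⨆ g ∈ {h : G | h ∈ degreeMonoid 𝒜 ∧ h ≠ 0}, 𝒜 g : AddSubgroup R) : Set R) =
      ↑(Ideal.span (Set.range x))) (g : G) :
    𝒜 g = monomialSpan 𝒜 x d g := by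
  refine le_antisymm ?_ (monomialSpan_le 𝒜 hx g)
  by_contra hg
  have hT : ∀ g, ¬ 𝒜 g ≤ monomialSpan 𝒜 x d g → g ∈ degreeMonoid 𝒜 := by
    intro g hg
    obtain ⟨r, hr, hr'⟩ := SetLike.not_le_iff_exists.1 hg
    exact mem_degreeMonoid hr fun h0 => hr' (h0 ▸ zero_mem _)
  obtain ⟨m, hm, hmin⟩ := hart {g | ¬ 𝒜 g ≤ monomialSpan 𝒜 x d g} hT ⟨g, hg⟩
  refine hm fun r hr => ?_
  have hm0 : m ≠ 0 := by
    rintro rfl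
    exact hm fun a ha => mem_monomialSpan_zero 𝒜 ha
  have hspan : r ∈ Ideal.span (Set.range x) := by
    rw [← SetLike.mem_coe, ← h]
    exact (mem_iSup_degreeMonoid_ne_zero_iff 𝒜).2 (decompose_of_mem_ne 𝒜 hr hm0)
  obtain ⟨c, rfl⟩ := Finsupp.mem_span_range_iff_exists_finsupp.1 hspan
  rw [← decompose_of_mem_same 𝒜 hr, Finsupp.sum, decompose_sum, DFinsupp.finsetSum_apply,
    AddSubgroup.val_finsetSum]
  refine sum_mem fun i _ => ?_
  have hterm : (decompose 𝒜 (c i • x i) m : R) = decompose 𝒜 (c i) (m - d i) * x i := by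
    conv_lhs => rw [← sub_add_cancel m (d i)]
    exact coe_decompose_mul_add_of_right_mem 𝒜 (hx i)
  rw [hterm]
  by_cases hxi : x i = 0
  · simp [hxi]
  have hdi := mem_degreeMonoid (hx i) hxi
  have hle : 𝒜 (m - d i) ≤ monomialSpan 𝒜 x d (m - d i) := by
    by_contra hn
    obtain ⟨s, hs, hms⟩ := hmin _ hn ⟨d i, hdi, (sub_add_cancel _ _).symm⟩
    rw [sub_eq_add_neg, add_right_inj] at hms
    exact hd i (hpos _ hdi (hms ▸ hs))
  simpa using mul_mem_monomialSpan 𝒜 (hle (decompose 𝒜 (c i) (m - d i)).2)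
    (mem_monomialSpan_self (d := d) 𝒜 i)

end MonomialSpan

/-- Let `R` be a positively `G`-graded ring and `(x_i)_{i∈I}` a family
of homogeneous elements of nonzero degrees. Consider: (1) each `R_g` is generated as an
`R_0`-module by the monomials in the `x_i` of degree `g`; (2) `R = R_0[x_i : i ∈ I]`;
(3) `R_+` is generated as an ideal by the `x_i`. Then (1) ⇔ (2) ⇒ (3), and if
`degmon(R)` is artinian then (1)–(3) are equivalent. -/
theorem positively_graded_generation_tfae
    {G : Type*} [AddCommGroup G] [DecidableEq G]
    {R : Type*} [CommRing R] (𝒜 : G → AddSubgroup R) [GradedRing 𝒜]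
    (hpos : ∀ g ∈ degreeMonoid 𝒜, -g ∈ degreeMonoid 𝒜 → g = 0)
    {I : Type*} (x : I → R) (d : I → G)
    (hx : ∀ i, x i ∈ 𝒜 (d i)) (hd : ∀ i, d i ≠ 0) :
    ((∀ g : G, 𝒜 g = AddSubgroup.closure
        {y : R | ∃ (a : R) (n : I →₀ ℕ), a ∈ 𝒜 (0 : G) ∧
          (∑ i ∈ n.support, n i • d i) = g ∧ y = a * ∏ i ∈ n.support, x i ^ n i}) ↔
      Subring.closure ((𝒜 (0 : G) : Set R) ∪ Set.range x) = ⊤) ∧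
    ((Subring.closure ((𝒜 (0 : G) : Set R) ∪ Set.range x) = ⊤) →
      ((⨆ g ∈ {h : G | h ∈ degreeMonoid 𝒜 ∧ h ≠ 0}, 𝒜 g : AddSubgroup R) : Set R) =
        ↑(Ideal.span (Set.range x))) ∧
    ((∀ T : Set G, T ⊆ (degreeMonoid 𝒜 : Set G) → T.Nonempty →
        ∃ m ∈ T, ∀ t ∈ T, (∃ s ∈ degreeMonoid 𝒜, m = t + s) →
          ∃ s ∈ degreeMonoid 𝒜, t = m + s) →
      ((((⨆ g ∈ {h : G | h ∈ degreeMonoid 𝒜 ∧ h ≠ 0}, 𝒜 g : AddSubgroup R) : Set R) =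
          ↑(Ideal.span (Set.range x))) →
        ∀ g : G, 𝒜 g = AddSubgroup.closure
          {y : R | ∃ (a : R) (n : I →₀ ℕ), a ∈ 𝒜 (0 : G) ∧
            (∑ i ∈ n.support, n i • d i) = g ∧ y = a * ∏ i ∈ n.support, x i ^ n i})) := by
  have hiff := forall_eq_monomialSpan_iff 𝒜 hx
  exact ⟨hiff, fun h => iSup_eq_span_of_forall_eq_monomialSpan 𝒜 hpos hx hd (hiff.2 h),
    forall_eq_monomialSpan_of_iSup_eq_span 𝒜 hpos hx hd⟩
end

section
/- Let R be positively G-graded, let F ⊆ G be a subgroup of finite index, suppose R is an R_0-algebra of finite type, and suppose the monoid degmon(R) ∩ F is artinian. Then R_(F) is an R_0-algebra of finite type. -/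
open DirectSum in
/-- A finite-type graded ring is generated over its degree-zero part by a finite family of
homogeneous elements. -/
theorem exists_finite_homogeneous_generators
    {G : Type*} [AddCommGroup G] [DecidableEq G] {R : Type*} [CommRing R]
    (𝒜 : G → AddSubgroup R) [GradedRing 𝒜]
    (hft : ∃ T : Finset R, Subring.closure ((𝒜 (0 : G) : Set R) ∪ ↑T) = ⊤) :
    ∃ H : Finset (R × G), (∀ p ∈ H, p.1 ∈ 𝒜 p.2) ∧
      Subring.closure ((𝒜 (0 : G) : Set R) ∪ Set.image Prod.fst (H : Set (R × G))) = ⊤ := by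
  classical
  obtain ⟨T, hT⟩ := hft
  refine ⟨T.biUnion fun t => (decompose 𝒜 t).support.image fun g => ((decompose 𝒜 t g : R), g),
    ?_, ?_⟩
  · intro p hp
    simp only [Finset.mem_biUnion, Finset.mem_image] at hp
    obtain ⟨t, -, g, -, rfl⟩ := hp
    exact SetLike.coe_mem _
  · rw [eq_top_iff, ← hT, Subring.closure_le]
    rintro r (hr | hr)
    · exact Subring.subset_closure (Or.inl hr)
    · rw [← sum_support_decompose 𝒜 r]
      refine sum_mem fun g hg => Subring.subset_closure (Or.inr ⟨(_, g), ?_, rfl⟩)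
      exact Finset.mem_biUnion.2 ⟨r, hr, Finset.mem_image.2 ⟨g, hg, rfl⟩⟩

/-- Every element of the multiplicative closure of a submonoid and a finite family is
an element of the submonoid times a monomial in the family. -/
theorem exists_eq_mul_prod_pow_of_mem_closure {ι M : Type*} [Fintype ι] [CommMonoid M]
    (A : Submonoid M) (x : ι → M) {m : M}
    (hm : m ∈ Submonoid.closure ((A : Set M) ∪ Set.range x)) :
    ∃ a ∈ A, ∃ e : ι → ℕ, m = a * ∏ i, x i ^ e i := by
  classical
  induction hm using Submonoid.closure_induction with
  | mem y hy =>
    rcases hy with hy | ⟨i, rfl⟩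
    · exact ⟨y, hy, 0, by simp⟩
    · exact ⟨1, A.one_mem, Pi.single i 1, by simp [Pi.single_apply, pow_ite]⟩
  | one => exact ⟨1, A.one_mem, 0, by simp⟩
  | mul y z _ _ hy hz =>
    obtain ⟨a, ha, e, rfl⟩ := hy
    obtain ⟨b, hb, f, rfl⟩ := hz
    refine ⟨a * b, A.mul_mem ha hb, e + f, ?_⟩
    simp only [Pi.add_apply, pow_add, Finset.prod_mul_distrib]
    exact mul_mul_mul_comm _ _ _ _

/-- A monomial whose degree lies in a subgroup `F` of finite index is a product of such
monomials with exponents at most the index of `F`. -/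
theorem prod_pow_mem_of_sum_nsmul_mem {ι G M : Type*} [Fintype ι] [AddCommGroup G] [CommMonoid M]
    (F : AddSubgroup G) (hF : F.FiniteIndex) (x : ι → M) (d : ι → G) (S : Submonoid M)
    (hS : ∀ e : ι → ℕ, (∀ i, e i ≤ F.index) → ∑ i, e i • d i ∈ F → ∏ i, x i ^ e i ∈ S)
    (e : ι → ℕ) (he : ∑ i, e i • d i ∈ F) : ∏ i, x i ^ e i ∈ S := by
  classical
  have hpow (i : ι) : x i ^ F.index ∈ S := by
    have h := hS (Pi.single i F.index)
      (fun j => by by_cases h : j = i <;> simp [h])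
      (by simpa [Pi.single_apply, ite_smul] using F.nsmul_index_mem (d i))
    simpa [Pi.single_apply, pow_ite] using h
  have hsplit : ∏ i, x i ^ e i =
      (∏ i, x i ^ (e i % F.index)) * ∏ i, (x i ^ F.index) ^ (e i / F.index) := by
    simp only [← Finset.prod_mul_distrib, ← pow_mul, ← pow_add, Nat.mod_add_div]
  rw [hsplit]
  refine S.mul_mem (hS _ (fun i => (Nat.mod_lt _ (Nat.pos_of_ne_zero hF.index_ne_zero)).le) ?_)
    (S.prod_mem fun i _ => S.pow_mem (hpow i) _)
  have hsum : ∑ i, e i • d i = ∑ i, (e i % F.index) • d i +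
      ∑ i, (e i / F.index) • F.index • d i := by
    simp only [← Finset.sum_add_distrib, ← mul_nsmul, ← add_nsmul, Nat.mod_add_div]
  rw [hsum] at he
  exact (F.add_mem_cancel_right
    (F.sum_mem fun i _ => F.nsmul_mem (F.nsmul_index_mem (d i)) _)).1 he


/-- Let `R` be a positively `G`-graded ring, `F ⊆ G` a subgroup of
finite index, suppose `R` is an `R_0`-algebra of finite type and that the monoid
`degmon(R) ∩ F` is artinian. Then `R_(F)` is an `R_0`-algebra of finite type. -/
theorem restriction_finite_type
    {G : Type*} [AddCommGroup G] [DecidableEq G]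
    {R : Type*} [CommRing R] (𝒜 : G → AddSubgroup R) [GradedRing 𝒜]
    (hpos : ∀ g ∈ degreeMonoid 𝒜, -g ∈ degreeMonoid 𝒜 → g = 0)
    (F : AddSubgroup G) (hFI : F.FiniteIndex)
    (hft : ∃ T : Finset R, Subring.closure ((𝒜 (0 : G) : Set R) ∪ ↑T) = ⊤)
    (hart : ∀ T : Set G, T ⊆ {g : G | g ∈ degreeMonoid 𝒜 ∧ g ∈ F} → T.Nonempty →
      ∃ m ∈ T, ∀ t ∈ T, (∃ s ∈ {g : G | g ∈ degreeMonoid 𝒜 ∧ g ∈ F}, m = t + s) →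
        ∃ s ∈ {g : G | g ∈ degreeMonoid 𝒜 ∧ g ∈ F}, t = m + s) :
    ∃ T : Finset R, ↑T ⊆ ((⨆ g ∈ F, 𝒜 g : AddSubgroup R) : Set R) ∧
      (Subring.closure ((𝒜 (0 : G) : Set R) ∪ ↑T) : Set R) =
        ↑(⨆ g ∈ F, 𝒜 g : AddSubgroup R) := by

  classical
  obtain ⟨H, hH, hgen⟩ := exists_finite_homogeneous_generators 𝒜 hft
  let x : H → R := fun p => p.1.1
  let d : H → G := fun p => p.1.2
  have hdeg (e : H → ℕ) : ∏ i, x i ^ e i ∈ 𝒜 (∑ i, e i • d i) :=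
    SetLike.prod_mem_graded _ _ _ fun i _ => SetLike.pow_mem_graded _ (hH i.1 i.2)
  let E : Finset (H → ℕ) := {e ∈ Fintype.piFinset fun _ => Finset.range (F.index + 1) |
    ∑ i, e i • d i ∈ F}
  let T : Finset R := E.image fun e => ∏ i, x i ^ e i
  have hTF : ∀ r ∈ T, ∃ g ∈ F, r ∈ 𝒜 g := by
    intro r hr
    obtain ⟨e, he, rfl⟩ := Finset.mem_image.1 hr
    exact ⟨_, (Finset.mem_filter.1 he).2, hdeg e⟩
  have hle {g : G} (hg : g ∈ F) : 𝒜 g ≤ ⨆ g ∈ F, 𝒜 g := le_iSup₂_of_le g hg le_rfl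
  refine ⟨T, fun r hr => ?_, Set.Subset.antisymm ?_ ?_⟩
  · obtain ⟨g, hg, hr⟩ := hTF r hr
    exact hle hg hr
  · intro r hr
    have hr' : r ∈ AddSubgroup.closure (Submonoid.closure ((𝒜 (0 : G) : Set R) ∪ T) : Set R) :=
      Subring.mem_closure_iff.1 hr
    refine (AddSubgroup.closure_le _).2 (fun m hm => ?_) hr'
    suffices ∃ g ∈ F, m ∈ 𝒜 g by
      obtain ⟨g, hg, hm⟩ := this
      exact hle hg hm
    induction hm using Submonoid.closure_induction with
    | mem y hy =>
      rcases hy with hy | hy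
      · exact ⟨0, F.zero_mem, hy⟩
      · exact hTF y hy
    | one => exact ⟨0, F.zero_mem, SetLike.one_mem_graded 𝒜⟩
    | mul y z _ _ hy hz =>
      obtain ⟨g, hg, hy⟩ := hy
      obtain ⟨h, hh, hz⟩ := hz
      exact ⟨g + h, F.add_mem hg hh, SetLike.mul_mem_graded hy hz⟩
  · set S := Subring.closure ((𝒜 (0 : G) : Set R) ∪ ↑T) with hSdef
    have hmon (e : H → ℕ) (he : ∑ i, e i • d i ∈ F) : ∏ i, x i ^ e i ∈ S := by
      refine prod_pow_mem_of_sum_nsmul_mem F hFI x d S.toSubmonoid (fun e hb he => ?_) e he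
      refine Subring.subset_closure (Or.inr (Finset.mem_image_of_mem _ ?_))
      exact Finset.mem_filter.2 ⟨Fintype.mem_piFinset.2 fun i =>
        Finset.mem_range.2 (Nat.lt_succ_of_le (hb i)), he⟩
    let A : Submonoid R :=
      { carrier := 𝒜 0
        one_mem' := SetLike.one_mem_graded 𝒜
        mul_mem' := fun ha hb => by simpa using SetLike.mul_mem_graded ha hb }
    have hrange : Set.range x = Set.image Prod.fst (H : Set (R × G)) := by
      ext r; simp [x]
    have hcomp (r : R) (g : G) (hg : g ∈ F) : (DirectSum.decompose 𝒜 r g : R) ∈ S := by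
      have hr : r ∈ AddSubgroup.closure
          (Submonoid.closure ((A : Set R) ∪ Set.range x) : Set R) := by
        rw [hrange]
        exact Subring.mem_closure_iff.1 (hgen ▸ Subring.mem_top r)
      induction hr using AddSubgroup.closure_induction with
      | mem m hm =>
        obtain ⟨a, ha, e, rfl⟩ := exists_eq_mul_prod_pow_of_mem_closure A x hm
        have hm : a * ∏ i, x i ^ e i ∈ 𝒜 (∑ i, e i • d i) := by
          simpa using SetLike.mul_mem_graded (A := 𝒜) ha (hdeg e)
        by_cases h : ∑ i, e i • d i = g
        · subst h
          rw [DirectSum.decompose_of_mem_same 𝒜 hm]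
          exact S.mul_mem (Subring.subset_closure (Or.inl ha)) (hmon e hg)
        · rw [DirectSum.decompose_of_mem_ne 𝒜 hm h]
          exact S.zero_mem
      | zero => simp
      | add y z _ _ hy hz => simpa using S.add_mem hy hz
      | neg y _ hy =>
        rw [DirectSum.decompose_neg]
        exact S.neg_mem hy
    have : (⨆ g ∈ F, 𝒜 g) ≤ S.toAddSubgroup := iSup₂_le fun g hg r hr => by
      simpa [DirectSum.decompose_of_mem_same 𝒜 hr] using hcomp r g hg
    exact this
end

section
/- Let C and D be categories, let T : C → C, S : D → D and F : D → C be functors, and let η : Id_C → T and ε : Id_D → S be natural transformations such that the natural transformations with components η_{T(X)} and T(η_X) are equal and form an isomorphism, and such that T(F(ε_A)) is an isomorphism for every object A of D. Then there exists a unique natural transformation ε' : F∘S → T∘F with ε'_A ∘ F(ε_A) = η_{F(A)} for every object A of D. Moreover, ε' is a monomorphism, epimorphism, or isomorphism (of functors) if and only if the natural transformation with components η_{F(S(A))} has the same property. -/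
open CategoryTheory

/-- If `T.map e` is invertible, a factorization of `η_X` through `e : X ⟶ Y` is determined by
`η_Y`. -/
theorem comp_map_eq_of_comp_eq_unit {C : Type*} [Category C] (T : C ⥤ C) (η : 𝟭 C ⟶ T)
    (hcomm : ∀ X : C, η.app (T.obj X) = T.map (η.app X))
    (hiso : ∀ X : C, IsIso (η.app (T.obj X)))
    {X Y : C} (e : X ⟶ Y) [IsIso (T.map e)] (g : Y ⟶ T.obj X) (hg : e ≫ g = η.app X) :
    g ≫ T.map e = η.app Y := by
  have hTg : T.map e ≫ T.map g = η.app (T.obj X) := by rw [← T.map_comp, hg, hcomm]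
  have hnat : g ≫ η.app (T.obj X) = η.app Y ≫ T.map g := η.naturality g
  have : IsIso (T.map e ≫ T.map g) := hTg ▸ hiso X
  have : IsIso (T.map g) := IsIso.of_isIso_comp_left (T.map e) (T.map g)
  rw [← cancel_mono (T.map g), Category.assoc, hTg, hnat]

/-- Let `C`, `D` be categories, `T : C ⥤ C`, `S : D ⥤ D`, `F : D ⥤ C`
functors, and `η : 𝟭 C ⟶ T`, `ε : 𝟭 D ⟶ S` natural transformations such that
`η_{T X} = T (η_X)` for all `X` and this is an isomorphism, and such that `T (F (ε_A))`
is an isomorphism for every `A`. Then there is a unique natural transformation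
`ε' : F ∘ S ⟶ T ∘ F` with `ε'_A ∘ F(ε_A) = η_{F A}` for every `A`; moreover `ε'` is a
mono-, epi- or isomorphism (componentwise) if and only if the natural transformation with
components `η_{F (S A)}` has the same property. -/
theorem exists_unique_natTrans_through_units
    {C D : Type*} [Category C] [Category D]
    (T : C ⥤ C) (S : D ⥤ D) (F : D ⥤ C) (η : 𝟭 C ⟶ T) (ε : 𝟭 D ⟶ S)
    (hcomm : ∀ X : C, η.app (T.obj X) = T.map (η.app X))
    (hiso : ∀ X : C, IsIso (η.app (T.obj X)))
    (hFε : ∀ A : D, IsIso (T.map (F.map (ε.app A)))) :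
    (∃! ε' : S ⋙ F ⟶ F ⋙ T, ∀ A : D, F.map (ε.app A) ≫ ε'.app A = η.app (F.obj A)) ∧
      ∀ ε' : S ⋙ F ⟶ F ⋙ T, (∀ A : D, F.map (ε.app A) ≫ ε'.app A = η.app (F.obj A)) →
        (((∀ A : D, Mono (ε'.app A)) ↔ ∀ A : D, Mono (η.app (F.obj (S.obj A)))) ∧
          ((∀ A : D, Epi (ε'.app A)) ↔ ∀ A : D, Epi (η.app (F.obj (S.obj A)))) ∧
          ((∀ A : D, IsIso (ε'.app A)) ↔ ∀ A : D, IsIso (η.app (F.obj (S.obj A))))) := by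
  have key : ∀ ε' : S ⋙ F ⟶ F ⋙ T,
      (∀ A : D, F.map (ε.app A) ≫ ε'.app A = η.app (F.obj A)) →
      ∀ A : D, ε'.app A ≫ T.map (F.map (ε.app A)) = η.app (F.obj (S.obj A)) :=
    fun ε' h A => comp_map_eq_of_comp_eq_unit T η hcomm hiso (F.map (ε.app A)) (ε'.app A) (h A)
  refine ⟨⟨⟨fun A => η.app (F.obj (S.obj A)) ≫ inv (T.map (F.map (ε.app A))), ?_⟩, ?_, ?_⟩, ?_⟩
  · intro A B f
    have hη : F.map (S.map f) ≫ η.app (F.obj (S.obj B)) =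
        η.app (F.obj (S.obj A)) ≫ T.map (F.map (S.map f)) := η.naturality (F.map (S.map f))
    have hε : f ≫ ε.app B = ε.app A ≫ S.map f := ε.naturality f
    have hTFε : T.map (F.map f) ≫ T.map (F.map (ε.app B)) =
        T.map (F.map (ε.app A)) ≫ T.map (F.map (S.map f)) := by
      simp only [← Functor.map_comp, hε]
    change F.map (S.map f) ≫ η.app (F.obj (S.obj B)) ≫ inv (T.map (F.map (ε.app B))) =
      (η.app (F.obj (S.obj A)) ≫ inv (T.map (F.map (ε.app A)))) ≫ T.map (F.map f)
    rw [← cancel_mono (T.map (F.map (ε.app B)))]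
    simp only [Category.assoc, IsIso.inv_hom_id, Category.comp_id, hTFε,
      IsIso.inv_hom_id_assoc, hη]
  · intro A
    have hη : F.map (ε.app A) ≫ η.app (F.obj (S.obj A)) =
        η.app (F.obj A) ≫ T.map (F.map (ε.app A)) := η.naturality (F.map (ε.app A))
    change F.map (ε.app A) ≫ η.app (F.obj (S.obj A)) ≫ inv (T.map (F.map (ε.app A))) = _
    rw [← Category.assoc, IsIso.comp_inv_eq]
    exact hη
  · intro ε' h
    ext A
    exact (IsIso.eq_comp_inv _).2 (key ε' h A)
  · intro ε' h
    have hinv (A : D) :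
        ε'.app A = η.app (F.obj (S.obj A)) ≫ inv (T.map (F.map (ε.app A))) :=
      (IsIso.eq_comp_inv _).2 (key ε' h A)
    refine ⟨forall_congr' fun A => ⟨fun hA => ?_, fun hA => ?_⟩,
      forall_congr' fun A => ⟨fun hA => ?_, fun hA => ?_⟩,
      forall_congr' fun A => ⟨fun hA => ?_, fun hA => ?_⟩⟩
    · rw [← key ε' h A]; exact mono_comp _ _
    · rw [hinv A]; exact mono_comp _ _
    · rw [← key ε' h A]; exact epi_comp _ _
    · rw [hinv A]; exact epi_comp _ _
    · rw [← key ε' h A]; exact IsIso.comp_isIso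
    · rw [hinv A]; exact IsIso.comp_isIso
end

section
/- Let σ ∈ Σ, let α ∈ Pic(Σ), and let R be a nontrivial commutative ring. Then there exists (m_ρ)_{ρ∈Σ₁} ∈ ℤ^{Σ₁} with m_ρ ≥ 0 for every ρ ∈ σ₁ and a((m_ρ)_ρ) = α such that the S_(σ)-module S_{σ,α} is free of rank 1 with basis the monomial ∏_{ρ∈Σ₁} Z_ρ^{m_ρ} ∈ S_σ. -/
open Module

noncomputable section
open scoped Classical

namespace ToricStmt

variable {V : Type*} [AddCommGroup V] [Module ℝ V]

section Cox

variable {V : Type*} [AddCommGroup V] [Module ℝ V]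

/-- The degree in `A_{Σ₁}` of an exponent vector of a monomial of the Cox ring. -/
def expDeg (N : Submodule ℤ V) {F : Set (Set V)} (gN : ↥(raysOf F) → N)
    (n : ↥(raysOf F) →₀ ℕ) : AMod N gN :=
  aQ N gN fun ρ => (n ρ : ℤ)

/-- The polynomial `x` in the Cox ring is homogeneous of degree `α`. -/
def CoxHomog (N : Submodule ℤ V) {F : Set (Set V)} (gN : ↥(raysOf F) → N)
    (R : Type*) [CommRing R] (α : AMod N gN) (x : MvPolynomial ↥(raysOf F) R) : Prop :=
  ∀ n ∈ x.support, expDeg N gN n = α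

/-- The exponent vector of the monomial `Ẑ_σ = ∏_{ρ ∈ Σ₁ \ σ₁} Z_ρ`. -/
def hatExp (F : Set (Set V)) [Fintype ↥(raysOf F)] (σ : Set V) : ↥(raysOf F) →₀ ℕ :=
  Finsupp.equivFunOnFinite.symm fun ρ => if IsFaceOf (ρ : Set V) σ then 0 else 1

/-- The monomial `Ẑ_σ = ∏_{ρ ∈ Σ₁ \ σ₁} Z_ρ` of the Cox ring. -/
def hatZ (F : Set (Set V)) [Fintype ↥(raysOf F)] (R : Type*) [CommRing R] (σ : Set V) :
    MvPolynomial ↥(raysOf F) R :=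
  MvPolynomial.monomial (hatExp F σ) (1 : R)

/-- The degree-`α` component `S_{σ,α}` of the localization `S_σ` of the Cox ring at
`Ẑ_σ`: the fractions `x / Ẑ_σ^k` with `x` homogeneous of degree `α + k·deg(Ẑ_σ)`. -/
def locComponent (N : Submodule ℤ V) (F : Set (Set V)) [Fintype ↥(raysOf F)]
    (gN : ↥(raysOf F) → N) (R : Type*) [CommRing R] (σ : Set V) (α : AMod N gN) :
    Set (Localization.Away (hatZ F R σ)) :=
  {y | ∃ (k : ℕ) (x : MvPolynomial ↥(raysOf F) R),
    CoxHomog N gN R (α + k • expDeg N gN (hatExp F σ)) x ∧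
    y * algebraMap (MvPolynomial ↥(raysOf F) R) (Localization.Away (hatZ F R σ))
        (hatZ F R σ ^ k)
      = algebraMap (MvPolynomial ↥(raysOf F) R) (Localization.Away (hatZ F R σ)) x}

end Cox

section LocComponent

variable {V : Type*} [AddCommGroup V] [Module ℝ V] (N : Submodule ℤ V) {F : Set (Set V)}
  (gN : ↥(raysOf F) → N)

lemma expDeg_add (n n' : ↥(raysOf F) →₀ ℕ) :
    expDeg N gN (n + n') = expDeg N gN n + expDeg N gN n' := by
  unfold expDeg
  rw [← map_add]
  congr 1

lemma CoxHomog.mul {R : Type*} [CommRing R] {α β : AMod N gN}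
    {x y : MvPolynomial ↥(raysOf F) R} (hx : CoxHomog N gN R α x) (hy : CoxHomog N gN R β y) :
    CoxHomog N gN R (α + β) (x * y) := by
  intro n hn
  obtain ⟨a, ha, b, hb, rfl⟩ := Finset.mem_add.mp (MvPolynomial.support_mul x y hn)
  rw [expDeg_add, hx a ha, hy b hb]

lemma coxHomog_monomial {R : Type*} [CommRing R] (n : ↥(raysOf F) →₀ ℕ) :
    CoxHomog N gN R (expDeg N gN n) (MvPolynomial.monomial n 1) := by
  intro n' hn'
  rw [Finset.mem_singleton.mp (MvPolynomial.support_monomial_subset hn')]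

lemma exists_rep_vanishing_on_rays {σ : Set V} (hσ : σ ∈ F)
    (hg : ∀ ρ : ↥(raysOf F), ((gN ρ : N) : V) ∈ (ρ : Set V))
    {α : AMod N gN} (hα : α ∈ picInA N F gN) :
    ∃ m : ↥(raysOf F) → ℤ, (∀ ρ : ↥(raysOf F), IsFaceOf (ρ : Set V) σ → m ρ = 0) ∧
      aQ N gN m = α := by
  obtain ⟨f, hf, rfl⟩ := hα
  refine ⟨dFam N F gN f - evalFam gN (f ⟨σ, hσ⟩), fun ρ hρ => ?_, ?_⟩
  · have h := hf ⟨σ, hσ⟩ ⟨ρ.1, ρ.2.1⟩ hρ (gN ρ) (hg ρ)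
    rw [LinearMap.sub_apply, sub_eq_zero] at h
    simp [dFam, evalFam, h]
  · have h : aQ N gN (evalFam gN (f ⟨σ, hσ⟩)) = 0 :=
      (Submodule.Quotient.mk_eq_zero _).mpr ⟨_, rfl⟩
    rw [map_sub, h, sub_zero]
    rfl

variable [Fintype ↥(raysOf F)]

lemma mul_mem_locComponent {R : Type*} [CommRing R] {σ : Set V} {α β : AMod N gN}
    {y z : Localization.Away (hatZ F R σ)} (hy : y ∈ locComponent N F gN R σ α)
    (hz : z ∈ locComponent N F gN R σ β) : y * z ∈ locComponent N F gN R σ (α + β) := by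
  obtain ⟨k, x, hx, hyx⟩ := hy
  obtain ⟨l, w, hw, hzw⟩ := hz
  refine ⟨k + l, x * w, ?_, ?_⟩
  · convert hx.mul N gN hw using 1
    rw [add_smul]
    abel
  · rw [pow_add, map_mul, map_mul, ← hyx, ← hzw]
    ring

/-- The exponent vector `m + k • hatExp F σ`, with negative entries truncated to `0`. -/
def shiftExp (F : Set (Set V)) [Fintype ↥(raysOf F)] (σ : Set V) (m : ↥(raysOf F) → ℤ) (k : ℕ) :
    ↥(raysOf F) →₀ ℕ :=
  Finsupp.equivFunOnFinite.symm fun ρ =>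
    (m ρ + (k : ℤ) * (if IsFaceOf (ρ : Set V) σ then 0 else 1)).toNat

lemma expDeg_shiftExp (σ : Set V) {m : ↥(raysOf F) → ℤ} {k : ℕ}
    (hk : ∀ ρ : ↥(raysOf F), 0 ≤ m ρ + (k : ℤ) * (if IsFaceOf (ρ : Set V) σ then 0 else 1)) :
    expDeg N gN (shiftExp F σ m k) = aQ N gN m + k • expDeg N gN (hatExp F σ) := by
  unfold expDeg
  rw [← map_nsmul, ← map_add]
  congr 1
  ext ρ
  simp only [shiftExp, hatExp, Finsupp.coe_equivFunOnFinite_symm, Int.toNat_of_nonneg (hk ρ),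
    Pi.add_apply, nsmul_eq_mul]
  push_cast
  rfl

lemma shiftExp_add_shiftExp_neg (σ : Set V) {m : ↥(raysOf F) → ℤ} {k : ℕ}
    (hk : ∀ ρ : ↥(raysOf F), 0 ≤ m ρ + (k : ℤ) * (if IsFaceOf (ρ : Set V) σ then 0 else 1))
    (hk' : ∀ ρ : ↥(raysOf F), 0 ≤ (-m) ρ + (k : ℤ) * (if IsFaceOf (ρ : Set V) σ then 0 else 1)) :
    shiftExp F σ m k + shiftExp F σ (-m) k = (k + k) • hatExp F σ := by
  ext ρ
  have h := hk ρ
  have h' := hk' ρ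
  simp only [shiftExp, hatExp, Finsupp.coe_equivFunOnFinite_symm, Finsupp.add_apply,
    Finsupp.smul_apply, smul_eq_mul, Pi.neg_apply] at h h' ⊢
  split_ifs at h h' ⊢ <;> omega

/-- The fraction `Z^(shiftExp F σ m k) / Ẑ_σ^k`. -/
def locMonomial (F : Set (Set V)) [Fintype ↥(raysOf F)] (R : Type*) [CommRing R] (σ : Set V)
    (m : ↥(raysOf F) → ℤ) (k : ℕ) : Localization.Away (hatZ F R σ) :=
  IsLocalization.mk' _ (MvPolynomial.monomial (shiftExp F σ m k) (1 : R))
    (⟨hatZ F R σ ^ k, k, rfl⟩ : Submonoid.powers (hatZ F R σ))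

lemma locMonomial_mul_hatZ_pow (R : Type*) [CommRing R] (σ : Set V) (m : ↥(raysOf F) → ℤ)
    (k : ℕ) :
    locMonomial F R σ m k * algebraMap (MvPolynomial ↥(raysOf F) R) _ (hatZ F R σ ^ k) =
      algebraMap (MvPolynomial ↥(raysOf F) R) _
        (MvPolynomial.monomial (shiftExp F σ m k) (1 : R)) :=
  IsLocalization.mk'_spec _ _ _

lemma locMonomial_mem_locComponent (R : Type*) [CommRing R] (σ : Set V)
    {m : ↥(raysOf F) → ℤ} {k : ℕ}
    (hk : ∀ ρ : ↥(raysOf F), 0 ≤ m ρ + (k : ℤ) * (if IsFaceOf (ρ : Set V) σ then 0 else 1)) :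
    locMonomial F R σ m k ∈ locComponent N F gN R σ (aQ N gN m) := by
  refine ⟨k, _, ?_, locMonomial_mul_hatZ_pow R σ m k⟩
  rw [← expDeg_shiftExp N gN σ hk]
  exact coxHomog_monomial N gN _

lemma locMonomial_mul_locMonomial_neg (R : Type*) [CommRing R] (σ : Set V)
    {m : ↥(raysOf F) → ℤ} {k : ℕ}
    (hk : ∀ ρ : ↥(raysOf F), 0 ≤ m ρ + (k : ℤ) * (if IsFaceOf (ρ : Set V) σ then 0 else 1))
    (hk' : ∀ ρ : ↥(raysOf F), 0 ≤ (-m) ρ + (k : ℤ) * (if IsFaceOf (ρ : Set V) σ then 0 else 1)) :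
    locMonomial F R σ m k * locMonomial F R σ (-m) k = 1 := by
  rw [locMonomial, locMonomial, ← IsLocalization.mk'_mul, MvPolynomial.monomial_mul, one_mul,
    shiftExp_add_shiftExp_neg σ hk hk']
  have h : MvPolynomial.monomial ((k + k) • hatExp F σ) (1 : R) =
      ((⟨hatZ F R σ ^ k, k, rfl⟩ * ⟨hatZ F R σ ^ k, k, rfl⟩ :
        Submonoid.powers (hatZ F R σ)) : MvPolynomial ↥(raysOf F) R) := by
    rw [Submonoid.coe_mul, ← pow_add, hatZ, MvPolynomial.monomial_pow, one_pow]
  rw [h, IsLocalization.mk'_self']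

end LocComponent

/-- Let `σ ∈ Σ`, let `α ∈ Pic(Σ)`, and let `R` be a nontrivial
commutative ring. Then there exists `(m_ρ)_{ρ∈Σ₁} ∈ ℤ^{Σ₁}` with `m_ρ ≥ 0` for every
`ρ ∈ σ₁` and `a((m_ρ)_ρ) = α` such that the `S_(σ)`-module `S_{σ,α}` is free of rank 1
with basis the monomial `∏_ρ Z_ρ^{m_ρ} ∈ S_σ`. -/
theorem locComponent_free_rank_one
    {V : Type*} [AddCommGroup V] [Module ℝ V] [FiniteDimensional ℝ V]
    (N : Submodule ℤ V) (hN : IsZStructure N)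
    (F : Set (Set V)) (hF : IsFan N F) [Fintype ↥(raysOf F)]
    (gN : ↥(raysOf F) → N)
    (hg : ∀ ρ : ↥(raysOf F), IsMinGen N (ρ : Set V) ((gN ρ : N) : V))
    (σ : Set V) (hσ : σ ∈ F)
    (α : AMod N gN) (hα : α ∈ picInA N F gN)
    (R : Type*) [CommRing R] [Nontrivial R] :
    ∃ m : ↥(raysOf F) → ℤ,
      (∀ ρ : ↥(raysOf F), IsFaceOf (ρ : Set V) σ → 0 ≤ m ρ) ∧
      aQ N gN m = α ∧
      ∃ (k : ℕ) (t : Localization.Away (hatZ F R σ)),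
        (∀ ρ : ↥(raysOf F),
          0 ≤ m ρ + (k : ℤ) * (if IsFaceOf (ρ : Set V) σ then 0 else 1)) ∧
        t * algebraMap (MvPolynomial ↥(raysOf F) R) (Localization.Away (hatZ F R σ))
            (hatZ F R σ ^ k)
          = algebraMap (MvPolynomial ↥(raysOf F) R) (Localization.Away (hatZ F R σ))
              (MvPolynomial.monomial
                (Finsupp.equivFunOnFinite.symm fun ρ =>
                  (m ρ + (k : ℤ) * (if IsFaceOf (ρ : Set V) σ then 0 else 1)).toNat)
                (1 : R)) ∧
        t ∈ locComponent N F gN R σ α ∧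
        ∀ y ∈ locComponent N F gN R σ α,
          ∃! s : Localization.Away (hatZ F R σ),
            s ∈ locComponent N F gN R σ 0 ∧ y = s * t := by
  obtain ⟨m, hm0, hmα⟩ := exists_rep_vanishing_on_rays N gN hσ (fun ρ => (hg ρ).2.1) hα
  have hbound : ∀ ρ, |m ρ| ≤ ((∑ ρ, (m ρ).natAbs : ℕ) : ℤ) := fun ρ => by
    rw [Int.abs_eq_natAbs]
    exact_mod_cast Finset.single_le_sum (f := fun ρ => (m ρ).natAbs)
      (fun _ _ => Nat.zero_le _) (Finset.mem_univ ρ)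
  generalize (∑ ρ, (m ρ).natAbs : ℕ) = k at hbound
  have hk : ∀ ρ : ↥(raysOf F),
      0 ≤ m ρ + (k : ℤ) * (if IsFaceOf (ρ : Set V) σ then 0 else 1) := fun ρ => by
    have h := abs_le.mp (hbound ρ)
    split_ifs with hρ
    · simp [hm0 ρ hρ]
    · linarith
  have hk' : ∀ ρ : ↥(raysOf F),
      0 ≤ (-m) ρ + (k : ℤ) * (if IsFaceOf (ρ : Set V) σ then 0 else 1) := fun ρ => by
    have h := abs_le.mp (hbound ρ)
    rw [Pi.neg_apply]
    split_ifs with hρ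
    · simp [hm0 ρ hρ]
    · linarith
  have hinv := locMonomial_mul_locMonomial_neg R σ hk hk'
  refine ⟨m, fun ρ hρ => (hm0 ρ hρ).ge, hmα, k, locMonomial F R σ m k, hk,
    locMonomial_mul_hatZ_pow R σ m k, hmα ▸ locMonomial_mem_locComponent N gN R σ hk,
    fun y hy => ⟨y * locMonomial F R σ (-m) k, ⟨?_, ?_⟩, ?_⟩⟩
  · have h := mul_mem_locComponent N gN hy (locMonomial_mem_locComponent N gN R σ hk')
    rwa [map_neg, hmα, add_neg_cancel] at h
  · rw [mul_assoc, mul_comm (locMonomial F R σ (-m) k), hinv, mul_one]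
  · rintro s ⟨-, rfl⟩
    rw [mul_assoc, hinv, mul_one]

end ToricStmt
end
end
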